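/- arXiv:1401.1793 — 7 statements merged into one kernel-verified Lean document; each statement's English description precedes it below -/
import Mathlib

section
/- Every finite 3-regular matchstick graph has at least 8 vertices. -/
/-- A matchstick embedding of a simple graph `G` in the plane: an injective map
`g` of the vertices into `ℝ²` such that every edge joins points at Euclidean
distance `1`, and the closed segments of any two vertex-disjoint edges are
disjoint. -/
def IsMatchstickEmbedding {V : Type*} (G : SimpleGraph V)
    (g : V → EuclideanSpace ℝ (Fin 2)) : Prop :=
  Function.Injective g ∧
  (∀ i j : V, G.Adj i j → dist (g i) (g j) = 1) ∧
  (∀ i₁ j₁ i₂ j₂ : V, G.Adj i₁ j₁ → G.Adj i₂ j₂ →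
    ({i₁, j₁} : Set V) ∩ ({i₂, j₂} : Set V) = ∅ →
    segment ℝ (g i₁) (g j₁) ∩ segment ℝ (g i₂) (g j₂) = ∅)

abbrev MSPlane := EuclideanSpace ℝ (Fin 2)

theorem ms_dist_one {p q : MSPlane} (h : dist p q = 1) :
    (p 0 - q 0) ^ 2 + (p 1 - q 1) ^ 2 = 1 := by
  rw [EuclideanSpace.dist_eq, Fin.sum_univ_two, Real.sqrt_eq_one] at h
  simpa [Real.dist_eq, sq_abs] using h

theorem ms_sq_pos {p q : MSPlane} (h : p ≠ q) :
    0 < (p 0 - q 0) ^ 2 + (p 1 - q 1) ^ 2 := by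
  by_contra hn
  apply h
  have h0 : p 0 - q 0 = 0 := by nlinarith [sq_nonneg (p 0 - q 0), sq_nonneg (p 1 - q 1)]
  have h1 : p 1 - q 1 = 0 := by nlinarith [sq_nonneg (p 0 - q 0), sq_nonneg (p 1 - q 1)]
  ext i
  fin_cases i
  · simpa using sub_eq_zero.mp h0
  · simpa using sub_eq_zero.mp h1

theorem ms_lin_zero (a b c d x y : ℝ) (h : a * c + b * d = 0)
    (hm : 0 < a ^ 2 + b ^ 2) (hn : 0 < c ^ 2 + d ^ 2)
    (h1 : a * x + b * y = 0) (h2 : c * x + d * y = 0) : x = 0 ∧ y = 0 := by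
  have hD : (a * d - b * c) ^ 2 = (a ^ 2 + b ^ 2) * (c ^ 2 + d ^ 2) := by
    have : (a * c + b * d) ^ 2 = 0 := by rw [h]; ring
    linarith [this, (by ring : (a * d - b * c) ^ 2 + (a * c + b * d) ^ 2
      = (a ^ 2 + b ^ 2) * (c ^ 2 + d ^ 2))]
  have hD0 : a * d - b * c ≠ 0 := by
    intro h0
    rw [h0] at hD
    have := mul_pos hm hn
    norm_num at hD
    rcases hD with h | h <;> linarith
  constructor
  · have : (a * d - b * c) * x = 0 := by linear_combination d * h1 - b * h2
    exact (mul_eq_zero.mp this).resolve_left hD0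
  · have : (a * d - b * c) * y = 0 := by linear_combination a * h2 - c * h1
    exact (mul_eq_zero.mp this).resolve_left hD0

/-- A unit four-cycle with distinct vertices is a rhombus. -/
theorem ms_rhombus {p q r s : MSPlane} (hpq : p ≠ q) (hrs : r ≠ s)
    (h1 : dist p r = 1) (h2 : dist p s = 1) (h3 : dist q r = 1) (h4 : dist q s = 1) :
    r + s = p + q := by
  have e1 := ms_dist_one h1
  have e2 := ms_dist_one h2
  have e3 := ms_dist_one h3
  have e4 := ms_dist_one h4
  obtain ⟨hx, hy⟩ := ms_lin_zero (p 0 - q 0) (p 1 - q 1) (r 0 - s 0) (r 1 - s 1)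
    (r 0 + s 0 - p 0 - q 0) (r 1 + s 1 - p 1 - q 1)
    (by linarith) (ms_sq_pos hpq) (ms_sq_pos hrs) (by linarith) (by linarith)
  ext i
  fin_cases i
  · simp; linarith
  · simp; linarith

/-- Vector from an apex through the opposite side. -/
theorem ms_cross {p p' q r : MSPlane} (x y : ℝ) (hx : 0 ≤ x) (hy : 0 ≤ y)
    (hn : x ^ 2 + x * y + y ^ 2 = 1) (hc : p' - p = x • (q - p) + y • (r - p)) :
    segment ℝ p p' ∩ segment ℝ q r ≠ ∅ := by
  have hs : 1 ≤ x + y := by nlinarith [mul_nonneg hx hy]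
  have hs0 : x + y ≠ 0 := by linarith
  have hp' : p' = p + (x • (q - p) + y • (r - p)) := by rw [← hc]; abel
  rw [← Set.nonempty_iff_ne_empty]
  refine ⟨(x / (x + y)) • q + (y / (x + y)) • r, ?_, ?_⟩
  · refine ⟨1 - 1 / (x + y), 1 / (x + y), ?_, by positivity, by ring, ?_⟩
    · rw [sub_nonneg, div_le_one (by linarith)]; exact hs
    · rw [hp']
      ext i
      simp
      field_simp
      ring
  · exact ⟨x / (x + y), y / (x + y), by positivity, by positivity, by field_simp, rfl⟩

theorem ms_coords {p q r p' : MSPlane} (h1 : dist p q = 1) (h2 : dist p r = 1)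
    (h3 : dist q r = 1) (h4 : dist p p' = 1) :
    ∃ x y : ℝ, x ^ 2 + x * y + y ^ 2 = 1 ∧ p' - p = x • (q - p) + y • (r - p) := by
  have e1 := ms_dist_one h1
  have e2 := ms_dist_one h2
  have e3 := ms_dist_one h3
  have e4 := ms_dist_one h4
  obtain ⟨a, ha⟩ : ∃ a, a = q 0 - p 0 := ⟨_, rfl⟩
  obtain ⟨b, hb⟩ : ∃ b, b = q 1 - p 1 := ⟨_, rfl⟩
  obtain ⟨c, hc⟩ : ∃ c, c = r 0 - p 0 := ⟨_, rfl⟩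
  obtain ⟨d, hd⟩ : ∃ d, d = r 1 - p 1 := ⟨_, rfl⟩
  obtain ⟨k, hk⟩ : ∃ k, k = p' 0 - p 0 := ⟨_, rfl⟩
  obtain ⟨l, hl⟩ : ∃ l, l = p' 1 - p 1 := ⟨_, rfl⟩
  have f1 : a ^ 2 + b ^ 2 = 1 := by rw [ha, hb]; linarith
  have f2 : c ^ 2 + d ^ 2 = 1 := by rw [hc, hd]; linarith
  have f3 : a * c + b * d = 1 / 2 := by rw [ha, hb, hc, hd]; linarith
  have f4 : k ^ 2 + l ^ 2 = 1 := by rw [hk, hl]; linarith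
  have hD : (a * d - b * c) ^ 2 = 3 / 4 := by
    linear_combination (c ^ 2 + d ^ 2) * f1 + f2 - (a * c + b * d + 1 / 2) * f3
  have hD0 : a * d - b * c ≠ 0 := by
    intro h0
    rw [h0] at hD
    norm_num at hD
  obtain ⟨x, hx⟩ : ∃ x, x = (k * d - l * c) / (a * d - b * c) := ⟨_, rfl⟩
  obtain ⟨y, hy⟩ : ∃ y, y = (a * l - b * k) / (a * d - b * c) := ⟨_, rfl⟩
  have g0 : k = x * a + y * c := by rw [hx, hy, div_mul_eq_mul_div, div_mul_eq_mul_div, ← add_div, eq_div_iff hD0]; ring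
  have g1 : l = x * b + y * d := by rw [hx, hy, div_mul_eq_mul_div, div_mul_eq_mul_div, ← add_div, eq_div_iff hD0]; ring
  refine ⟨x, y, ?_, ?_⟩
  · rw [g0, g1] at f4
    linear_combination f4 - x ^ 2 * f1 - y ^ 2 * f2 - 2 * x * y * f3
  · ext i
    fin_cases i
    · simp [← ha, ← hc, ← hk]; exact g0
    · simp [← hb, ← hd, ← hl]; exact g1

theorem ms_prism_cross {p q r p' q' r' : MSPlane} (h1 : dist p q = 1) (h2 : dist p r = 1)
    (h3 : dist q r = 1) (h4 : dist p p' = 1)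
    (hq : q' - q = p' - p) (hr : r' - r = p' - p)
    (A1 : segment ℝ p p' ∩ segment ℝ q r = ∅)
    (A2 : segment ℝ q q' ∩ segment ℝ p r = ∅)
    (A3 : segment ℝ r r' ∩ segment ℝ p q = ∅)
    (B1 : segment ℝ p' p ∩ segment ℝ q' r' = ∅)
    (B2 : segment ℝ q' q ∩ segment ℝ p' r' = ∅)
    (B3 : segment ℝ r' r ∩ segment ℝ p' q' = ∅) : False := by
  obtain ⟨x, y, hn, hc⟩ := ms_coords h1 h2 h3 h4
  have hp' : p' = p + (x • (q - p) + y • (r - p)) := by rw [← hc]; abel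
  have hq' : q' = q + (x • (q - p) + y • (r - p)) := by rw [← hc, ← hq]; abel
  have hr' : r' = r + (x • (q - p) + y • (r - p)) := by rw [← hc, ← hr]; abel
  rcases le_total 0 x with hx | hx <;> rcases le_total 0 y with hy | hy
  · exact ms_cross x y hx hy hn hc A1
  · rcases le_total 0 (-x - y) with hz | hz
    · exact ms_cross (-x - y) x hz hx (by linarith) (by rw [hr']; module) A3
    · exact ms_cross (x + y) (-y) (by linarith) (by linarith) (by linarith)
        (by rw [hp', hq', hr']; module) B2
  · rcases le_total 0 (-x - y) with hz | hz
    · exact ms_cross (-x - y) y hz hy (by linarith) (by rw [hq']; module) A2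
    · exact ms_cross (x + y) (-x) (by linarith) (by linarith) (by linarith)
        (by rw [hp', hq', hr']; module) B3
  · exact ms_cross (-x) (-y) (by linarith) (by linarith) (by linarith)
        (by rw [hp', hq', hr']; module) B1

section graph
variable {V : Type} {G : SimpleGraph V} {g : V → MSPlane}

theorem ms_par (hg : IsMatchstickEmbedding G g) {p q r s : V} (hpq : p ≠ q) (hrs : r ≠ s)
    (h1 : G.Adj p r) (h2 : G.Adj p s) (h3 : G.Adj q r) (h4 : G.Adj q s) :
    g r + g s = g p + g q :=
  ms_rhombus (hg.1.ne hpq) (hg.1.ne hrs) (hg.2.1 _ _ h1) (hg.2.1 _ _ h2) (hg.2.1 _ _ h3)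
    (hg.2.1 _ _ h4)

theorem ms_K23 (hg : IsMatchstickEmbedding G g) {p q r s t : V} (hpq : p ≠ q) (hrs : r ≠ s)
    (hrt : r ≠ t) (hst : s ≠ t)
    (h1 : G.Adj p r) (h2 : G.Adj p s) (h3 : G.Adj q r) (h4 : G.Adj q s)
    (h5 : G.Adj p t) (h6 : G.Adj q t) : False := by
  have e1 := ms_par hg hpq hrs h1 h2 h3 h4
  have e2 := ms_par hg hpq hrt h1 h5 h3 h6
  exact hst (hg.1 (add_left_cancel (e1.trans e2.symm)))

theorem ms_K4 (hg : IsMatchstickEmbedding G g) {p q r s : V}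
    (h1 : G.Adj p q) (h2 : G.Adj p r) (h3 : G.Adj p s) (h4 : G.Adj q r) (h5 : G.Adj q s)
    (h6 : G.Adj r s) : False := by
  have e1 := ms_par hg h1.ne h6.ne h2 h3 h4 h5
  have e2 := ms_par hg h2.ne h5.ne h1 h3 h4.symm h6
  apply h4.ne
  apply hg.1
  have : (2 : ℝ) • g q = (2 : ℝ) • g r := by
    have e3 : (2 : ℝ) • g q - (2 : ℝ) • g r
        = ((g q + g s) - (g p + g r)) - ((g r + g s) - (g p + g q)) := by module
    rw [e1, e2, sub_self, sub_self, sub_self] at e3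
    exact sub_eq_zero.mp e3
  exact smul_right_injective _ (two_ne_zero) this

theorem ms_prism (hg : IsMatchstickEmbedding G g) {p q r p' q' r' : V}
    (h1 : G.Adj p q) (h2 : G.Adj p r) (h3 : G.Adj q r)
    (h4 : G.Adj p' q') (h5 : G.Adj p' r') (h6 : G.Adj q' r')
    (h7 : G.Adj p p') (h8 : G.Adj q q') (h9 : G.Adj r r')
    (hd : [p, q, r, p', q', r'].Nodup) : False := by
  simp only [List.nodup_cons, List.mem_cons, not_or, List.not_mem_nil, not_false_eq_true,
    and_true, List.nodup_nil] at hd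
  obtain ⟨⟨-, -, n1, n2, n3⟩, ⟨-, n4, n5, n6⟩, ⟨n7, n8, n9⟩, -⟩ := hd
  have e1 := ms_par hg n2 n4 h1 h7 h8.symm h4.symm
  have e2 := ms_par hg n3 n7 h2 h7 h9.symm h5.symm
  have D : ∀ a b c d : V, G.Adj a b → G.Adj c d → a ≠ c → a ≠ d → b ≠ c → b ≠ d →
      segment ℝ (g a) (g b) ∩ segment ℝ (g c) (g d) = ∅ := by
    intro a b c d hab hcd m1 m2 m3 m4
    refine hg.2.2 a b c d hab hcd ?_
    ext z
    simp only [Set.mem_inter_iff, Set.mem_insert_iff, Set.mem_singleton_iff,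
      Set.mem_empty_iff_false, iff_false]
    rintro ⟨rfl | rfl, rfl | rfl⟩ <;> simp_all
  have s1 : g q' - g q = g p' - g p := by
    rw [sub_eq_sub_iff_add_eq_add, add_comm (g q'), ← e1, add_comm]
  have s2 : g r' - g r = g p' - g p := by
    rw [sub_eq_sub_iff_add_eq_add, add_comm (g r'), ← e2, add_comm]
  refine ms_prism_cross (hg.2.1 _ _ h1) (hg.2.1 _ _ h2) (hg.2.1 _ _ h3) (hg.2.1 _ _ h7) s1 s2
    (D _ _ _ _ h7 h3 ?_ ?_ ?_ ?_) (D _ _ _ _ h8 h2 ?_ ?_ ?_ ?_) (D _ _ _ _ h9 h1 ?_ ?_ ?_ ?_)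
    (D _ _ _ _ h7.symm h6 ?_ ?_ ?_ ?_) (D _ _ _ _ h8.symm h5 ?_ ?_ ?_ ?_)
    (D _ _ _ _ h9.symm h4 ?_ ?_ ?_ ?_)
  all_goals first
    | assumption
    | (apply Ne.symm; assumption)
    | exact h1.ne
    | exact h1.ne.symm
    | exact h2.ne
    | exact h2.ne.symm
    | exact h3.ne
    | exact h3.ne.symm
    | exact h4.ne
    | exact h4.ne.symm
    | exact h5.ne
    | exact h5.ne.symm
    | exact h6.ne
    | exact h6.ne.symm

end graph

set_option synthInstance.maxSize 100000 in
set_option synthInstance.maxHeartbeats 0 in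
set_option maxRecDepth 100000 in
theorem ms_bool : ∀ ad bd cd de ae be ce ab ac bc : Bool,
    ad.toNat + bd.toNat + cd.toNat + de.toNat = 3 →
    ae.toNat + be.toNat + ce.toNat + de.toNat = 3 →
    1 + ab.toNat + ac.toNat + ad.toNat + ae.toNat = 3 →
    1 + ab.toNat + bc.toNat + bd.toNat + be.toNat = 3 →
    1 + ac.toNat + bc.toNat + cd.toNat + ce.toNat = 3 →
    (ad = true ∧ bd = true ∧ cd = true) ∨
    (de = true ∧
      ((ab = true ∧ cd = true ∧ ce = true ∧ ad = true ∧ be = true) ∨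
       (ab = true ∧ cd = true ∧ ce = true ∧ ae = true ∧ bd = true) ∨
       (ac = true ∧ bd = true ∧ be = true ∧ ad = true ∧ ce = true) ∨
       (ac = true ∧ bd = true ∧ be = true ∧ ae = true ∧ cd = true) ∨
       (bc = true ∧ ad = true ∧ ae = true ∧ bd = true ∧ ce = true) ∨
       (bc = true ∧ ad = true ∧ ae = true ∧ be = true ∧ cd = true))) := by
  decide

/-- Every finite `3`-regular matchstick graph has at least `8` vertices. -/
theorem three_regular_matchstick_graph_card_ge_eight
    (V : Type) [Fintype V] [Nonempty V] (G : SimpleGraph V)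
    (g : V → EuclideanSpace ℝ (Fin 2))
    (hreg : ∀ v : V, (G.neighborSet v).ncard = 3)
    (hg : IsMatchstickEmbedding G g) :
    8 ≤ Fintype.card V := by
  classical
  by_contra hlt
  push Not at hlt
  have hdeg : ∀ v, G.degree v = 3 := by
    intro v
    rw [← hreg v, ← SimpleGraph.card_neighborSet_eq_degree, Set.ncard_eq_toFinset_card',
      Set.toFinset_card]
  have hsum := G.sum_degrees_eq_twice_card_edges
  simp only [hdeg, Finset.sum_const, Finset.card_univ, smul_eq_mul] at hsum
  obtain ⟨v⟩ := ‹Nonempty V›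
  have hlt3 := G.degree_lt_card_verts v
  rw [hdeg] at hlt3
  obtain ⟨a, b, c, hab, hac, hbc, hN⟩ := Set.ncard_eq_three.mp (hreg v)
  have adjv : ∀ w, G.Adj v w ↔ w = a ∨ w = b ∨ w = c := by
    intro w
    rw [← SimpleGraph.mem_neighborSet, hN]
    simp
  have va : G.Adj v a := (adjv a).2 (by simp)
  have vb : G.Adj v b := (adjv b).2 (by simp)
  have vc : G.Adj v c := (adjv c).2 (by simp)
  have hS : ({v, a, b, c} : Finset V).card = 4 := by
    have := va.ne
    have := vb.ne
    have := vc.ne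
    rw [Finset.card_insert_of_notMem, Finset.card_insert_of_notMem,
      Finset.card_insert_of_notMem, Finset.card_singleton] <;> simp_all
  have hdegsum : ∀ w, ∑ z, (decide (G.Adj w z)).toNat = 3 := by
    intro w
    rw [← hdeg w, ← SimpleGraph.card_neighborFinset_eq_degree,
      SimpleGraph.neighborFinset_eq_filter, Finset.card_filter]
    apply Finset.sum_congr rfl
    intro z _
    by_cases h : G.Adj w z <;> simp [h]
  have hcases : Fintype.card V = 4 ∨ Fintype.card V = 6 := by omega
  rcases hcases with h4 | h6
  · have huniv : (Finset.univ : Finset V) = {v, a, b, c} :=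
      (Finset.eq_univ_of_card _ (by rw [hS, h4])).symm
    have hall : ∀ x y, x ≠ y → G.Adj x y := by
      intro x y hxy
      have hs : G.neighborFinset x = Finset.univ.erase x := by
        apply Finset.eq_of_subset_of_card_le
        · intro z hz
          simp only [SimpleGraph.mem_neighborFinset] at hz
          simp [hz.ne']
        · rw [Finset.card_erase_of_mem (Finset.mem_univ _), Finset.card_univ, h4,
            SimpleGraph.card_neighborFinset_eq_degree, hdeg]
      rw [← SimpleGraph.mem_neighborFinset, hs]
      simp [hxy.symm]
    exact ms_K4 hg va vb vc (hall _ _ hab) (hall _ _ hac) (hall _ _ hbc)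
  · have hcompl : (({v, a, b, c} : Finset V)ᶜ).card = 2 := by
      rw [Finset.card_compl, hS, h6]
    obtain ⟨d, e, hde, hC⟩ := Finset.card_eq_two.mp hcompl
    have hd : d ∉ ({v, a, b, c} : Finset V) := by
      rw [← Finset.mem_compl, hC]; simp
    have he : e ∉ ({v, a, b, c} : Finset V) := by
      rw [← Finset.mem_compl, hC]; simp
    simp only [Finset.mem_insert, Finset.mem_singleton, not_or] at hd he
    obtain ⟨hdv, hda, hdb, hdc⟩ := hd
    obtain ⟨hev, hea, heb, hec⟩ := he
    have nva := va.ne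
    have nvb := vb.ne
    have nvc := vc.ne
    have huniv : (Finset.univ : Finset V) = {v, a, b, c, d, e} := by
      ext z
      simp only [Finset.mem_univ, true_iff]
      by_cases hz : z ∈ ({v, a, b, c} : Finset V)
      · simp only [Finset.mem_insert, Finset.mem_singleton] at hz ⊢
        tauto
      · rw [← Finset.mem_compl, hC] at hz
        simp only [Finset.mem_insert, Finset.mem_singleton] at hz ⊢
        tauto
    have hsix : ∀ f : V → ℕ, ∑ z, f z = f v + f a + f b + f c + f d + f e := by
      intro f
      rw [huniv, Finset.sum_insert, Finset.sum_insert, Finset.sum_insert, Finset.sum_insert,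
        Finset.sum_insert, Finset.sum_singleton]
      · ring
      all_goals simp only [Finset.mem_insert, Finset.mem_singleton, not_or]
      · exact hde
      · exact ⟨Ne.symm hdc, Ne.symm hec⟩
      · exact ⟨hbc, Ne.symm hdb, Ne.symm heb⟩
      · exact ⟨hab, hac, Ne.symm hda, Ne.symm hea⟩
      · exact ⟨nva, nvb, nvc, Ne.symm hdv, Ne.symm hev⟩
    have nvd : ¬ G.Adj v d := by rw [adjv]; tauto
    have nve : ¬ G.Adj v e := by rw [adjv]; tauto
    have ka := hdegsum a
    have kb := hdegsum b
    have kc := hdegsum c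
    have kd := hdegsum d
    have ke := hdegsum e
    rw [hsix] at ka kb kc kd ke
    rw [G.adj_comm a v] at ka
    rw [G.adj_comm b v, G.adj_comm b a] at kb
    rw [G.adj_comm c v, G.adj_comm c a, G.adj_comm c b] at kc
    rw [G.adj_comm d v, G.adj_comm d a, G.adj_comm d b, G.adj_comm d c] at kd
    rw [G.adj_comm e v, G.adj_comm e a, G.adj_comm e b, G.adj_comm e c, G.adj_comm e d] at ke
    simp only [va, vb, vc, nvd, nve, G.irrefl, decide_true, decide_false, Bool.toNat_true,
      Bool.toNat_false] at ka kb kc kd ke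
    have key := ms_bool (decide (G.Adj a d)) (decide (G.Adj b d)) (decide (G.Adj c d))
      (decide (G.Adj d e)) (decide (G.Adj a e)) (decide (G.Adj b e)) (decide (G.Adj c e))
      (decide (G.Adj a b)) (decide (G.Adj a c)) (decide (G.Adj b c))
      (by omega) (by omega) (by omega) (by omega) (by omega)
    simp only [decide_eq_true_eq] at key
    rcases key with ⟨x1, x2, x3⟩ | ⟨y, key⟩
    · exact ms_K23 hg (Ne.symm hdv) hab hac hbc va vb x1.symm x2.symm vc x3.symm
    · rcases key with ⟨k1, k2, k3, k4, k5⟩ | ⟨k1, k2, k3, k4, k5⟩ | ⟨k1, k2, k3, k4, k5⟩ |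
        ⟨k1, k2, k3, k4, k5⟩ | ⟨k1, k2, k3, k4, k5⟩ | ⟨k1, k2, k3, k4, k5⟩
      · exact ms_prism hg va vb k1 k2 k3 y vc k4 k5 (by simp; grind)
      · exact ms_prism hg va vb k1 k3 k2 y.symm vc k4 k5 (by simp; grind)
      · exact ms_prism hg va vc k1 k2 k3 y vb k4 k5 (by simp; grind)
      · exact ms_prism hg va vc k1 k3 k2 y.symm vb k4 k5 (by simp; grind)
      · exact ms_prism hg vb vc k1 k2 k3 y va k4 k5 (by simp; grind)
      · exact ms_prism hg vb vc k1 k3 k2 y.symm va k4 k5 (by simp; grind)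
end

section
/- There exists a finite 3-regular matchstick graph with exactly 8 vertices. -/
/-- Twice the x-coordinate of the vertices. -/
def mX : Fin 8 → ℤ := ![0, 2, 1, 3, 0, 2, 1, 3]
/-- Integer part of the y-coordinate. -/
def mM : Fin 8 → ℤ := ![0, 0, 0, 0, 1, 1, 1, 1]
/-- Coefficient of `√3/2` in the y-coordinate. -/
def mK : Fin 8 → ℤ := ![0, 0, 1, 1, 0, 0, 1, 1]

/-- Edge list. -/
def mE : List (Fin 8 × Fin 8) :=
  [(0,1),(0,2),(1,2),(1,3),(2,3),(4,5),(4,6),(5,6),(5,7),(6,7),(0,4),(3,7)]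

/-- Separating functionals. -/
def mF : List (ℤ × ℤ) := [(-2, -8), (1, 4), (-8, 1), (2, -1), (-2, 8), (0, -8)]

/-- Scaled value of a functional at a vertex when `√3/2` is replaced by `s/1000`. -/
def mval (v : ℤ × ℤ) (i : Fin 8) (s : ℤ) : ℤ :=
  1000 * v.1 * mX i + 2 * v.2 * (1000 * mM i + mK i * s)

/-- Certified comparison. -/
def mlt (v : ℤ × ℤ) (i j : Fin 8) : Prop :=
  mval v i 866 < mval v j 866 ∧ mval v i 867 < mval v j 867

instance (v : ℤ × ℤ) (i j : Fin 8) : Decidable (mlt v i j) := by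
  unfold mlt; infer_instance

/-- The embedding. -/
noncomputable def mg (i : Fin 8) : EuclideanSpace ℝ (Fin 2) :=
  !₂[(mX i : ℝ) / 2, (mM i : ℝ) + mK i * (√3 / 2)]

/-- The graph. -/
def mG : SimpleGraph (Fin 8) where
  Adj i j := (i, j) ∈ mE ∨ (j, i) ∈ mE
  symm := ⟨fun _ _ h => h.symm⟩
  loopless := ⟨by decide⟩

instance : DecidableRel mG.Adj := fun i j =>
  inferInstanceAs (Decidable ((i, j) ∈ mE ∨ (j, i) ∈ mE))

/-- Real functional. -/
def mf (v : ℤ × ℤ) (p : EuclideanSpace ℝ (Fin 2)) : ℝ := v.1 * p 0 + v.2 * p 1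

lemma mf_lt {v : ℤ × ℤ} {i j : Fin 8} (h : mlt v i j) : mf v (mg i) < mf v (mg j) := by
  obtain ⟨h1, h2⟩ := h
  unfold mval at h1 h2
  have h1' := (Int.cast_lt (R := ℝ)).2 h1
  have h2' := (Int.cast_lt (R := ℝ)).2 h2
  push_cast at h1' h2'
  have hs : (√3) ^ 2 = 3 := Real.sq_sqrt (by norm_num)
  have hlo : 1.732 ≤ √3 := Real.le_sqrt_of_sq_le (by norm_num)
  have hhi : √3 ≤ 1.734 := Real.sqrt_le_iff.2 ⟨by norm_num, by norm_num⟩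
  simp only [mf, mg, PiLp.toLp_apply, Matrix.cons_val_zero, Matrix.cons_val_one]
  rcases le_total (0 : ℝ) ((v.2 : ℝ) * ((mK i : ℝ) - mK j)) with hc | hc
  · nlinarith [mul_le_mul_of_nonneg_left hhi hc]
  · nlinarith [mul_le_mul_of_nonpos_left hlo hc]

lemma seg_disj (v : ℤ × ℤ) {a b c d : EuclideanSpace ℝ (Fin 2)}
    (h1 : mf v a < mf v c) (h2 : mf v a < mf v d) (h3 : mf v b < mf v c)
    (h4 : mf v b < mf v d) : segment ℝ a b ∩ segment ℝ c d = ∅ := by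
  rw [Set.eq_empty_iff_forall_notMem]
  rintro p ⟨⟨s, t, hs, ht, hst, rfl⟩, ⟨s', t', hs', ht', hst', he⟩⟩
  have key : s' * mf v c + t' * mf v d = s * mf v a + t * mf v b := by
    have := congrArg (mf v) he
    simp only [mf, PiLp.add_apply, PiLp.smul_apply, smul_eq_mul] at this ⊢
    linarith
  have hm : max (mf v a) (mf v b) < min (mf v c) (mf v d) := by
    simp [h1, h2, h3, h4]
  have e1 : s * mf v a + t * mf v b ≤ max (mf v a) (mf v b) := by
    calc _ ≤ s * max (mf v a) (mf v b) + t * max (mf v a) (mf v b) := by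
          gcongr
          · exact le_max_left _ _
          · exact le_max_right _ _
      _ = _ := by rw [← add_mul, hst, one_mul]
  have e2 : min (mf v c) (mf v d) ≤ s' * mf v c + t' * mf v d := by
    calc _ = s' * min (mf v c) (mf v d) + t' * min (mf v c) (mf v d) := by
          rw [← add_mul, hst', one_mul]
      _ ≤ _ := by
          gcongr
          · exact min_le_left _ _
          · exact min_le_right _ _
  linarith

set_option maxRecDepth 100000 in
lemma cert : ∀ e ∈ mE, ∀ f ∈ mE, (e.1 = f.1 ∨ e.1 = f.2 ∨ e.2 = f.1 ∨ e.2 = f.2) ∨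
    ∃ v ∈ mF, mlt v e.1 f.1 ∧ mlt v e.1 f.2 ∧ mlt v e.2 f.1 ∧ mlt v e.2 f.2 := by
  decide +kernel

lemma cert_inj : ∀ i j : Fin 8, i = j ∨ ∃ v ∈ mF, mlt v i j := by
  decide +kernel

lemma cert_len : ∀ e ∈ mE, (mX e.1 - mX e.2) ^ 2 + 4 * (mM e.1 - mM e.2) ^ 2
      + 3 * (mK e.1 - mK e.2) ^ 2 = 4 ∧ (mM e.1 - mM e.2) * (mK e.1 - mK e.2) = 0 := by
  decide +kernel

lemma edge_dist {i j : Fin 8} (h : (i, j) ∈ mE) : dist (mg i) (mg j) = 1 := by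
  obtain ⟨h1, h2⟩ := cert_len _ h
  have h1' := congrArg (Int.cast (R := ℝ)) h1
  have h2' := congrArg (Int.cast (R := ℝ)) h2
  push_cast at h1' h2'
  have hs : (√3) ^ 2 = 3 := Real.sq_sqrt (by norm_num)
  rw [EuclideanSpace.dist_eq, Real.sqrt_eq_one, Fin.sum_univ_two, Real.dist_eq, Real.dist_eq,
    sq_abs, sq_abs]
  simp only [mg, PiLp.toLp_apply, Matrix.cons_val_zero, Matrix.cons_val_one]
  linear_combination h1' / 4 + √3 * h2' + ((mK i : ℝ) - mK j) ^ 2 / 4 * hs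

lemma edge_disj {a b c d : Fin 8} (h : (a, b) ∈ mE) (h' : (c, d) ∈ mE)
    (h1 : a ≠ c) (h2 : a ≠ d) (h3 : b ≠ c) (h4 : b ≠ d) :
    segment ℝ (mg a) (mg b) ∩ segment ℝ (mg c) (mg d) = ∅ := by
  rcases cert _ h _ h' with hh | ⟨v, -, k1, k2, k3, k4⟩
  · simp_all
  · exact seg_disj v (mf_lt k1) (mf_lt k2) (mf_lt k3) (mf_lt k4)

/-- There exists a finite `3`-regular matchstick graph with exactly `8` vertices. -/
theorem exists_three_regular_matchstick_graph_on_eight_vertices :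
    ∃ (G : SimpleGraph (Fin 8)) (g : Fin 8 → EuclideanSpace ℝ (Fin 2)),
      (∀ v : Fin 8, (G.neighborSet v).ncard = 3) ∧ IsMatchstickEmbedding G g := by
  refine ⟨mG, mg, ?_, ?_, ?_, ?_⟩
  · intro v
    rw [Set.ncard_eq_toFinset_card']
    revert v
    decide +kernel
  · intro i j h
    rcases cert_inj i j with h' | ⟨v, -, hv⟩
    · exact h'
    · exact absurd (mf_lt hv) (by rw [h]; exact lt_irrefl _)
  · rintro i j (h | h)
    · exact edge_dist h
    · rw [dist_comm]; exact edge_dist h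
  · intro a b c d h h' hne
    have hn : ∀ x, x ∈ ({a, b} : Set (Fin 8)) → x ∈ ({c, d} : Set (Fin 8)) → False :=
      fun x hx hy => by
        have : x ∈ ({a, b} : Set (Fin 8)) ∩ {c, d} := ⟨hx, hy⟩
        rw [hne] at this; exact this
    have h1 : a ≠ c := fun e => hn a (by simp) (by simp [e])
    have h2 : a ≠ d := fun e => hn a (by simp) (by simp [e])
    have h3 : b ≠ c := fun e => hn b (by simp) (by simp [e])
    have h4 : b ≠ d := fun e => hn b (by simp) (by simp [e])
    rcases h with h | h <;> rcases h' with h' | h'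
    · exact edge_disj h h' h1 h2 h3 h4
    · rw [segment_symm ℝ (mg c)]; exact edge_disj h h' h2 h1 h4 h3
    · rw [segment_symm ℝ (mg a)]; exact edge_disj h h' h3 h4 h1 h2
    · rw [segment_symm ℝ (mg a), segment_symm ℝ (mg c)]
      exact edge_disj h h' h4 h3 h2 h1
end

section
/- There exists a finite 4-regular matchstick graph with exactly 52 vertices (the Harborth graph); in particular the minimum number m(4) of vertices of a 4-regular matchstick graph satisfies m(4) ≤ 52. -/
namespace Harborth

/-! ### Elementary interval bounds -/

lemma pm_bd {x y a b c d l u : ℝ} (h1 : a ≤ x) (h2 : x ≤ b) (h3 : c ≤ y) (h4 : y ≤ d)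
    (ha : 0 ≤ a) (hc : 0 ≤ c) (hl : l ≤ a * c) (hu : b * d ≤ u) : l ≤ x * y ∧ x * y ≤ u := by
  constructor
  · exact hl.trans (mul_le_mul h1 h3 hc (ha.trans h1))
  · exact (mul_le_mul h2 h4 (hc.trans h3) ((ha.trans h1).trans h2)).trans hu

lemma sq_bd {t l u : ℝ} (_hl : 0 ≤ l) (hu : 0 ≤ u) (h1 : l ^ 2 ≤ t) (h2 : t ≤ u ^ 2) :
    l ≤ √t ∧ √t ≤ u :=
  ⟨Real.le_sqrt_of_sq_le h1, (Real.sqrt_le_left hu).2 h2⟩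

lemma inv_bd {t a b l u : ℝ} (h1 : a ≤ t) (h2 : t ≤ b) (ha : 0 < a) (hl : l * b ≤ 1)
    (hu : 1 ≤ u * a) : l ≤ 1 / t ∧ 1 / t ≤ u := by
  have ht : 0 < t := ha.trans_le h1
  have hb : 0 < b := ht.trans_le h2
  constructor
  · calc l ≤ 1 / b := by rwa [le_div_iff₀ hb]
      _ ≤ 1 / t := one_div_le_one_div_of_le ht h2
  · calc 1 / t ≤ 1 / a := one_div_le_one_div_of_le ha h1
      _ ≤ u := by rwa [div_le_iff₀ ha]

/-! ### The one-parameter family of linkages -/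

noncomputable def rr : ℝ := √3
noncomputable def cc (s : ℝ) : ℝ := √(1 - s * s)
noncomputable def qq (s : ℝ) : ℝ := √(4 - s * s)
noncomputable def Dx (s : ℝ) : ℝ := (cc s + qq s) / 2 + rr * s
noncomputable def Dy (s : ℝ) : ℝ := (rr * qq s - rr * cc s) / 2
noncomputable def d2 (s : ℝ) : ℝ := Dx s * Dx s + Dy s * Dy s
noncomputable def hh (s : ℝ) : ℝ := √(1 / d2 s - 1 / 4)
noncomputable def Ex (s : ℝ) : ℝ := Dx s / 2 - hh s * Dy s
noncomputable def Ey (s : ℝ) : ℝ := Dy s / 2 + hh s * Dx s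
noncomputable def mm (s : ℝ) : ℝ := (rr * Ey s - Ex s) / 2
noncomputable def kk (s : ℝ) : ℝ := √(1 - mm s * mm s)
noncomputable def ga (s : ℝ) : ℝ := 3 / 2 * (Ex s + rr * Ey s) - Dx s
noncomputable def gb (s : ℝ) : ℝ := Dy s - 2 * Ey s + rr * Ex s - kk s
noncomputable def FF (s : ℝ) : ℝ := ga s * ga s + gb s * gb s - 1

lemma box_a {s : ℝ} (sl : 0.1564 ≤ s) (su : s ≤ 0.1564) :
    0 ≤ FF s := by
  obtain ⟨rl, ru⟩ : 1.73205 ≤ rr ∧ rr ≤ 1.732051 := sq_bd (by norm_num) (by norm_num) (by norm_num) (by norm_num)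
  obtain ⟨ssl, ssu⟩ : 0.02446 ≤ s * s ∧ s * s ≤ 0.024461 := pm_bd sl su sl su (by norm_num) (by norm_num) (by norm_num) (by norm_num)
  obtain ⟨cl, cu⟩ : 0.987693 ≤ cc s ∧ cc s ≤ 0.987695 := sq_bd (by norm_num) (by norm_num) (by linarith) (by linarith)
  obtain ⟨ql, qu⟩ : 1.993875 ≤ qq s ∧ qq s ≤ 1.993876 := sq_bd (by norm_num) (by norm_num) (by linarith) (by linarith)
  obtain ⟨rsl, rsu⟩ : 0.270892 ≤ rr * s ∧ rr * s ≤ 0.270893 := pm_bd rl ru sl su (by norm_num) (by norm_num) (by norm_num) (by norm_num)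
  obtain ⟨rcl, rcu⟩ : 1.710733 ≤ rr * cc s ∧ rr * cc s ≤ 1.710739 := pm_bd rl ru cl cu (by norm_num) (by norm_num) (by norm_num) (by norm_num)
  obtain ⟨rql, rqu⟩ : 3.453491 ≤ rr * qq s ∧ rr * qq s ≤ 3.453495 := pm_bd rl ru ql qu (by norm_num) (by norm_num) (by norm_num) (by norm_num)
  obtain ⟨Dxl, Dxu⟩ : 1.761676 ≤ Dx s ∧ Dx s ≤ 1.761679 := by
    have e : Dx s = (cc s + qq s) / 2 + rr * s := rfl
    constructor <;> linarith
  obtain ⟨Dyl, Dyu⟩ : 0.871376 ≤ Dy s ∧ Dy s ≤ 0.871381 := by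
    have e : Dy s = (rr * qq s - rr * cc s) / 2 := rfl
    constructor <;> linarith
  obtain ⟨Dxxl, Dxxu⟩ : 3.103502 ≤ Dx s * Dx s ∧ Dx s * Dx s ≤ 3.103513 := pm_bd Dxl Dxu Dxl Dxu (by norm_num) (by norm_num) (by norm_num) (by norm_num)
  obtain ⟨Dyyl, Dyyu⟩ : 0.759296 ≤ Dy s * Dy s ∧ Dy s * Dy s ≤ 0.759305 := pm_bd Dyl Dyu Dyl Dyu (by norm_num) (by norm_num) (by norm_num) (by norm_num)
  obtain ⟨dl, du⟩ : 3.862798 ≤ d2 s ∧ d2 s ≤ 3.862818 := by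
    have e : d2 s = Dx s * Dx s + Dy s * Dy s := rfl
    constructor <;> linarith
  obtain ⟨il, iu⟩ : 0.258878 ≤ 1 / d2 s ∧ 1 / d2 s ≤ 0.25888 := inv_bd dl du (by norm_num) (by norm_num) (by norm_num)
  obtain ⟨hl, hu⟩ : 0.094223 ≤ hh s ∧ hh s ≤ 0.094234 := sq_bd (by norm_num) (by norm_num) (by linarith) (by linarith)
  obtain ⟨hDyl, hDyu⟩ : 0.082103 ≤ hh s * Dy s ∧ hh s * Dy s ≤ 0.082114 := pm_bd hl hu Dyl Dyu (by norm_num) (by norm_num) (by norm_num) (by norm_num)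
  obtain ⟨hDxl, hDxu⟩ : 0.16599 ≤ hh s * Dx s ∧ hh s * Dx s ≤ 0.166011 := pm_bd hl hu Dxl Dxu (by norm_num) (by norm_num) (by norm_num) (by norm_num)
  obtain ⟨Exl, Exu⟩ : 0.798724 ≤ Ex s ∧ Ex s ≤ 0.798737 := by
    have e : Ex s = Dx s / 2 - hh s * Dy s := rfl
    constructor <;> linarith
  obtain ⟨Eyl, Eyu⟩ : 0.601678 ≤ Ey s ∧ Ey s ≤ 0.601702 := by
    have e : Ey s = Dy s / 2 + hh s * Dx s := rfl
    constructor <;> linarith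
  obtain ⟨rExl, rExu⟩ : 1.383429 ≤ rr * Ex s ∧ rr * Ex s ≤ 1.383454 := pm_bd rl ru Exl Exu (by norm_num) (by norm_num) (by norm_num) (by norm_num)
  obtain ⟨rEyl, rEyu⟩ : 1.042136 ≤ rr * Ey s ∧ rr * Ey s ≤ 1.042179 := pm_bd rl ru Eyl Eyu (by norm_num) (by norm_num) (by norm_num) (by norm_num)
  obtain ⟨ml, mu⟩ : 0.121699 ≤ mm s ∧ mm s ≤ 0.121728 := by
    have e : mm s = (rr * Ey s - Ex s) / 2 := rfl
    constructor <;> linarith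
  obtain ⟨mmml, mmmu⟩ : 0.01481 ≤ mm s * mm s ∧ mm s * mm s ≤ 0.014818 := pm_bd ml mu ml mu (by norm_num) (by norm_num) (by norm_num) (by norm_num)
  obtain ⟨kl, ku⟩ : 0.992563 ≤ kk s ∧ kk s ≤ 0.992568 := sq_bd (by norm_num) (by norm_num) (by linarith) (by linarith)
  obtain ⟨gal, gau⟩ : 0.999611 ≤ ga s ∧ ga s ≤ 0.999698 := by
    have e : ga s = 3 / 2 * (Ex s + rr * Ey s) - Dx s := rfl
    constructor <;> linarith
  obtain ⟨gbl, gbu⟩ : 0.058833 ≤ gb s ∧ gb s ≤ 0.058916 := by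
    have e : gb s = Dy s - 2 * Ey s + rr * Ex s - kk s := rfl
    constructor <;> linarith
  obtain ⟨gaal, gaau⟩ : 0.999222 ≤ ga s * ga s ∧ ga s * ga s ≤ 0.999397 := pm_bd gal gau gal gau (by norm_num) (by norm_num) (by norm_num) (by norm_num)
  obtain ⟨gbbl, gbbu⟩ : 0.003461 ≤ gb s * gb s ∧ gb s * gb s ≤ 0.003472 := pm_bd gbl gbu gbl gbu (by norm_num) (by norm_num) (by norm_num) (by norm_num)
  obtain ⟨Fl, Fu⟩ : 0.002683 ≤ FF s ∧ FF s ≤ 0.002869 := by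
    have e : FF s = ga s * ga s + gb s * gb s - 1 := rfl
    constructor <;> linarith
  linarith

lemma box_b {s : ℝ} (sl : 0.1568 ≤ s) (su : s ≤ 0.1568) :
    FF s ≤ 0 := by
  obtain ⟨rl, ru⟩ : 1.73205 ≤ rr ∧ rr ≤ 1.732051 := sq_bd (by norm_num) (by norm_num) (by norm_num) (by norm_num)
  obtain ⟨ssl, ssu⟩ : 0.024586 ≤ s * s ∧ s * s ≤ 0.024587 := pm_bd sl su sl su (by norm_num) (by norm_num) (by norm_num) (by norm_num)
  obtain ⟨cl, cu⟩ : 0.987629 ≤ cc s ∧ cc s ≤ 0.987631 := sq_bd (by norm_num) (by norm_num) (by linarith) (by linarith)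
  obtain ⟨ql, qu⟩ : 1.993843 ≤ qq s ∧ qq s ≤ 1.993845 := sq_bd (by norm_num) (by norm_num) (by linarith) (by linarith)
  obtain ⟨rsl, rsu⟩ : 0.271585 ≤ rr * s ∧ rr * s ≤ 0.271586 := pm_bd rl ru sl su (by norm_num) (by norm_num) (by norm_num) (by norm_num)
  obtain ⟨rcl, rcu⟩ : 1.710622 ≤ rr * cc s ∧ rr * cc s ≤ 1.710628 := pm_bd rl ru cl cu (by norm_num) (by norm_num) (by norm_num) (by norm_num)
  obtain ⟨rql, rqu⟩ : 3.453435 ≤ rr * qq s ∧ rr * qq s ≤ 3.453442 := pm_bd rl ru ql qu (by norm_num) (by norm_num) (by norm_num) (by norm_num)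
  obtain ⟨Dxl, Dxu⟩ : 1.762321 ≤ Dx s ∧ Dx s ≤ 1.762324 := by
    have e : Dx s = (cc s + qq s) / 2 + rr * s := rfl
    constructor <;> linarith
  obtain ⟨Dyl, Dyu⟩ : 0.871403 ≤ Dy s ∧ Dy s ≤ 0.87141 := by
    have e : Dy s = (rr * qq s - rr * cc s) / 2 := rfl
    constructor <;> linarith
  obtain ⟨Dxxl, Dxxu⟩ : 3.105775 ≤ Dx s * Dx s ∧ Dx s * Dx s ≤ 3.105786 := pm_bd Dxl Dxu Dxl Dxu (by norm_num) (by norm_num) (by norm_num) (by norm_num)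
  obtain ⟨Dyyl, Dyyu⟩ : 0.759343 ≤ Dy s * Dy s ∧ Dy s * Dy s ≤ 0.759356 := pm_bd Dyl Dyu Dyl Dyu (by norm_num) (by norm_num) (by norm_num) (by norm_num)
  obtain ⟨dl, du⟩ : 3.865118 ≤ d2 s ∧ d2 s ≤ 3.865142 := by
    have e : d2 s = Dx s * Dx s + Dy s * Dy s := rfl
    constructor <;> linarith
  obtain ⟨il, iu⟩ : 0.258722 ≤ 1 / d2 s ∧ 1 / d2 s ≤ 0.258725 := inv_bd dl du (by norm_num) (by norm_num) (by norm_num)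
  obtain ⟨hl, hu⟩ : 0.093391 ≤ hh s ∧ hh s ≤ 0.093408 := sq_bd (by norm_num) (by norm_num) (by linarith) (by linarith)
  obtain ⟨hDyl, hDyu⟩ : 0.081381 ≤ hh s * Dy s ∧ hh s * Dy s ≤ 0.081397 := pm_bd hl hu Dyl Dyu (by norm_num) (by norm_num) (by norm_num) (by norm_num)
  obtain ⟨hDxl, hDxu⟩ : 0.164584 ≤ hh s * Dx s ∧ hh s * Dx s ≤ 0.164616 := pm_bd hl hu Dxl Dxu (by norm_num) (by norm_num) (by norm_num) (by norm_num)
  obtain ⟨Exl, Exu⟩ : 0.799763 ≤ Ex s ∧ Ex s ≤ 0.799781 := by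
    have e : Ex s = Dx s / 2 - hh s * Dy s := rfl
    constructor <;> linarith
  obtain ⟨Eyl, Eyu⟩ : 0.600285 ≤ Ey s ∧ Ey s ≤ 0.600321 := by
    have e : Ey s = Dy s / 2 + hh s * Dx s := rfl
    constructor <;> linarith
  obtain ⟨rExl, rExu⟩ : 1.385229 ≤ rr * Ex s ∧ rr * Ex s ≤ 1.385262 := pm_bd rl ru Exl Exu (by norm_num) (by norm_num) (by norm_num) (by norm_num)
  obtain ⟨rEyl, rEyu⟩ : 1.039723 ≤ rr * Ey s ∧ rr * Ey s ≤ 1.039787 := pm_bd rl ru Eyl Eyu (by norm_num) (by norm_num) (by norm_num) (by norm_num)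
  obtain ⟨ml, mu⟩ : 0.119971 ≤ mm s ∧ mm s ≤ 0.120012 := by
    have e : mm s = (rr * Ey s - Ex s) / 2 := rfl
    constructor <;> linarith
  obtain ⟨mmml, mmmu⟩ : 0.014393 ≤ mm s * mm s ∧ mm s * mm s ≤ 0.014403 := pm_bd ml mu ml mu (by norm_num) (by norm_num) (by norm_num) (by norm_num)
  obtain ⟨kl, ku⟩ : 0.992772 ≤ kk s ∧ kk s ≤ 0.992778 := sq_bd (by norm_num) (by norm_num) (by linarith) (by linarith)
  obtain ⟨gal, gau⟩ : 0.996905 ≤ ga s ∧ ga s ≤ 0.997031 := by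
    have e : ga s = 3 / 2 * (Ex s + rr * Ey s) - Dx s := rfl
    constructor <;> linarith
  obtain ⟨gbl, gbu⟩ : 0.063212 ≤ gb s ∧ gb s ≤ 0.06333 := by
    have e : gb s = Dy s - 2 * Ey s + rr * Ex s - kk s := rfl
    constructor <;> linarith
  obtain ⟨gaal, gaau⟩ : 0.993819 ≤ ga s * ga s ∧ ga s * ga s ≤ 0.994071 := pm_bd gal gau gal gau (by norm_num) (by norm_num) (by norm_num) (by norm_num)
  obtain ⟨gbbl, gbbu⟩ : 0.003995 ≤ gb s * gb s ∧ gb s * gb s ≤ 0.004011 := pm_bd gbl gbu gbl gbu (by norm_num) (by norm_num) (by norm_num) (by norm_num)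
  obtain ⟨Fl, Fu⟩ : (-0.002186) ≤ FF s ∧ FF s ≤ (-0.001918) := by
    have e : FF s = ga s * ga s + gb s * gb s - 1 := rfl
    constructor <;> linarith
  linarith

lemma box_w {s : ℝ} (sl : 0.1564 ≤ s) (su : s ≤ 0.1568) :
    (0.987629 ≤ cc s ∧ cc s ≤ 0.987695) ∧
    (1.993843 ≤ qq s ∧ qq s ≤ 1.993876) ∧
    (3.86258 ≤ d2 s ∧ d2 s ≤ 3.865359) ∧
    (0.258708 ≤ 1 / d2 s ∧ 1 / d2 s ≤ 0.258895) ∧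
    (0.093316 ≤ hh s ∧ hh s ≤ 0.094314) ∧
    (0.992532 ≤ kk s ∧ kk s ≤ 0.992807) ∧
    (0.11973 ≤ mm s ∧ mm s ≤ 0.12198) ∧
    (0.798625 ≤ Ex s ∧ Ex s ≤ 0.799876) ∧
    (0.600062 ≤ Ey s ∧ Ey s ≤ 0.601936) ∧
    (0.270892 ≤ rr * s ∧ rr * s ≤ 0.271586) ∧
    (1.710622 ≤ rr * cc s ∧ rr * cc s ≤ 1.710739) ∧
    (3.453435 ≤ rr * qq s ∧ rr * qq s ≤ 3.453495) ∧
    (1.383258 ≤ rr * Ex s ∧ rr * Ex s ≤ 1.385427) ∧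
    (1.039337 ≤ rr * Ey s ∧ rr * Ey s ≤ 1.042584) ∧
    (1.73205 ≤ rr ∧ rr ≤ 1.732051) ∧
    (0.994571 ≤ ga s ∧ ga s ≤ 1.002062) ∧
    (0.057927 ≤ gb s ∧ gb s ≤ 0.064208) ∧
    (1.761628 ≤ Dx s ∧ Dx s ≤ 1.762372) ∧
    (0.871348 ≤ Dy s ∧ Dy s ≤ 0.871437) := by
  obtain ⟨rl, ru⟩ : 1.73205 ≤ rr ∧ rr ≤ 1.732051 := sq_bd (by norm_num) (by norm_num) (by norm_num) (by norm_num)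
  obtain ⟨ssl, ssu⟩ : 0.02446 ≤ s * s ∧ s * s ≤ 0.024587 := pm_bd sl su sl su (by norm_num) (by norm_num) (by norm_num) (by norm_num)
  obtain ⟨cl, cu⟩ : 0.987629 ≤ cc s ∧ cc s ≤ 0.987695 := sq_bd (by norm_num) (by norm_num) (by linarith) (by linarith)
  obtain ⟨ql, qu⟩ : 1.993843 ≤ qq s ∧ qq s ≤ 1.993876 := sq_bd (by norm_num) (by norm_num) (by linarith) (by linarith)
  obtain ⟨rsl, rsu⟩ : 0.270892 ≤ rr * s ∧ rr * s ≤ 0.271586 := pm_bd rl ru sl su (by norm_num) (by norm_num) (by norm_num) (by norm_num)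
  obtain ⟨rcl, rcu⟩ : 1.710622 ≤ rr * cc s ∧ rr * cc s ≤ 1.710739 := pm_bd rl ru cl cu (by norm_num) (by norm_num) (by norm_num) (by norm_num)
  obtain ⟨rql, rqu⟩ : 3.453435 ≤ rr * qq s ∧ rr * qq s ≤ 3.453495 := pm_bd rl ru ql qu (by norm_num) (by norm_num) (by norm_num) (by norm_num)
  obtain ⟨Dxl, Dxu⟩ : 1.761628 ≤ Dx s ∧ Dx s ≤ 1.762372 := by
    have e : Dx s = (cc s + qq s) / 2 + rr * s := rfl
    constructor <;> linarith
  obtain ⟨Dyl, Dyu⟩ : 0.871348 ≤ Dy s ∧ Dy s ≤ 0.871437 := by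
    have e : Dy s = (rr * qq s - rr * cc s) / 2 := rfl
    constructor <;> linarith
  obtain ⟨Dxxl, Dxxu⟩ : 3.103333 ≤ Dx s * Dx s ∧ Dx s * Dx s ≤ 3.105956 := pm_bd Dxl Dxu Dxl Dxu (by norm_num) (by norm_num) (by norm_num) (by norm_num)
  obtain ⟨Dyyl, Dyyu⟩ : 0.759247 ≤ Dy s * Dy s ∧ Dy s * Dy s ≤ 0.759403 := pm_bd Dyl Dyu Dyl Dyu (by norm_num) (by norm_num) (by norm_num) (by norm_num)
  obtain ⟨dl, du⟩ : 3.86258 ≤ d2 s ∧ d2 s ≤ 3.865359 := by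
    have e : d2 s = Dx s * Dx s + Dy s * Dy s := rfl
    constructor <;> linarith
  obtain ⟨il, iu⟩ : 0.258708 ≤ 1 / d2 s ∧ 1 / d2 s ≤ 0.258895 := inv_bd dl du (by norm_num) (by norm_num) (by norm_num)
  obtain ⟨hl, hu⟩ : 0.093316 ≤ hh s ∧ hh s ≤ 0.094314 := sq_bd (by norm_num) (by norm_num) (by linarith) (by linarith)
  obtain ⟨hDyl, hDyu⟩ : 0.08131 ≤ hh s * Dy s ∧ hh s * Dy s ≤ 0.082189 := pm_bd hl hu Dyl Dyu (by norm_num) (by norm_num) (by norm_num) (by norm_num)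
  obtain ⟨hDxl, hDxu⟩ : 0.164388 ≤ hh s * Dx s ∧ hh s * Dx s ≤ 0.166217 := pm_bd hl hu Dxl Dxu (by norm_num) (by norm_num) (by norm_num) (by norm_num)
  obtain ⟨Exl, Exu⟩ : 0.798625 ≤ Ex s ∧ Ex s ≤ 0.799876 := by
    have e : Ex s = Dx s / 2 - hh s * Dy s := rfl
    constructor <;> linarith
  obtain ⟨Eyl, Eyu⟩ : 0.600062 ≤ Ey s ∧ Ey s ≤ 0.601936 := by
    have e : Ey s = Dy s / 2 + hh s * Dx s := rfl
    constructor <;> linarith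
  obtain ⟨rExl, rExu⟩ : 1.383258 ≤ rr * Ex s ∧ rr * Ex s ≤ 1.385427 := pm_bd rl ru Exl Exu (by norm_num) (by norm_num) (by norm_num) (by norm_num)
  obtain ⟨rEyl, rEyu⟩ : 1.039337 ≤ rr * Ey s ∧ rr * Ey s ≤ 1.042584 := pm_bd rl ru Eyl Eyu (by norm_num) (by norm_num) (by norm_num) (by norm_num)
  obtain ⟨ml, mu⟩ : 0.11973 ≤ mm s ∧ mm s ≤ 0.12198 := by
    have e : mm s = (rr * Ey s - Ex s) / 2 := rfl
    constructor <;> linarith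
  obtain ⟨mmml, mmmu⟩ : 0.014335 ≤ mm s * mm s ∧ mm s * mm s ≤ 0.01488 := pm_bd ml mu ml mu (by norm_num) (by norm_num) (by norm_num) (by norm_num)
  obtain ⟨kl, ku⟩ : 0.992532 ≤ kk s ∧ kk s ≤ 0.992807 := sq_bd (by norm_num) (by norm_num) (by linarith) (by linarith)
  obtain ⟨gal, gau⟩ : 0.994571 ≤ ga s ∧ ga s ≤ 1.002062 := by
    have e : ga s = 3 / 2 * (Ex s + rr * Ey s) - Dx s := rfl
    constructor <;> linarith
  obtain ⟨gbl, gbu⟩ : 0.057927 ≤ gb s ∧ gb s ≤ 0.064208 := by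
    have e : gb s = Dy s - 2 * Ey s + rr * Ex s - kk s := rfl
    constructor <;> linarith
  exact ⟨⟨cl, cu⟩, ⟨ql, qu⟩, ⟨dl, du⟩, ⟨il, iu⟩, ⟨hl, hu⟩, ⟨kl, ku⟩, ⟨ml, mu⟩, ⟨Exl, Exu⟩, ⟨Eyl, Eyu⟩, ⟨rsl, rsu⟩, ⟨rcl, rcu⟩, ⟨rql, rqu⟩, ⟨rExl, rExu⟩, ⟨rEyl, rEyu⟩, ⟨rl, ru⟩, ⟨gal, gau⟩, ⟨gbl, gbu⟩, ⟨Dxl, Dxu⟩, ⟨Dyl, Dyu⟩⟩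


lemma FF_cont : ContinuousOn FF (Set.Icc 0.1564 0.1568) := by
  have h1 : Continuous cc := by unfold cc; fun_prop
  have h2 : Continuous qq := by unfold qq; fun_prop
  have h3 : Continuous Dx := by unfold Dx; fun_prop
  have h4 : Continuous Dy := by unfold Dy; fun_prop
  have h5 : Continuous d2 := by unfold d2; fun_prop
  have h6 : ContinuousOn hh (Set.Icc 0.1564 0.1568) := by
    unfold hh
    refine Real.continuous_sqrt.comp_continuousOn (ContinuousOn.sub ?_ continuousOn_const)
    refine ContinuousOn.div continuousOn_const h5.continuousOn ?_
    intro s hs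
    obtain ⟨⟨cl, cu⟩, ⟨ql, qu⟩, ⟨dl, du⟩, ⟨il, iu⟩, ⟨hl, hu⟩, ⟨kl, ku⟩, ⟨ml, mu⟩, ⟨Exl, Exu⟩, ⟨Eyl, Eyu⟩, ⟨rsl, rsu⟩, ⟨rcl, rcu⟩, ⟨rql, rqu⟩, ⟨rExl, rExu⟩, ⟨rEyl, rEyu⟩, ⟨rl, ru⟩, ⟨gal, gau⟩, ⟨gbl, gbu⟩, ⟨Dxl, Dxu⟩, ⟨Dyl, Dyu⟩⟩ := box_w hs.1 hs.2
    intro h0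
    rw [h0] at dl
    norm_num at dl
  have h3' := h3.continuousOn (s := Set.Icc 0.1564 0.1568)
  have h4' := h4.continuousOn (s := Set.Icc 0.1564 0.1568)
  have h7 : ContinuousOn Ex (Set.Icc 0.1564 0.1568) := by unfold Ex; fun_prop
  have h8 : ContinuousOn Ey (Set.Icc 0.1564 0.1568) := by unfold Ey; fun_prop
  have h9 : ContinuousOn mm (Set.Icc 0.1564 0.1568) := by unfold mm; fun_prop
  have h10 : ContinuousOn kk (Set.Icc 0.1564 0.1568) := by
    unfold kk
    exact Real.continuous_sqrt.comp_continuousOn (by fun_prop)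
  unfold FF ga gb
  fun_prop

lemma exists_root : ∃ s : ℝ, 0.1564 ≤ s ∧ s ≤ 0.1568 ∧ FF s = 0 := by
  have h := intermediate_value_Icc' (a := (0.1564 : ℝ)) (b := 0.1568) (by norm_num) FF_cont
  obtain ⟨s, hs, h0⟩ := h ⟨box_b le_rfl le_rfl, box_a le_rfl le_rfl⟩
  exact ⟨s, hs.1, hs.2, h0⟩

/-! ### A quarter of the graph -/

/-- Edges in a fundamental quarter of the graph. -/
def quarterEdges : List (Fin 15 × Fin 15) := [(0, 1), (1, 2), (0, 3), (1, 3), (2, 4), (1, 5), (2, 5), (3, 5), (2, 6), (4, 6), (5, 6), (3, 7), (4, 8), (6, 9), (7, 9), (4, 10), (8, 10), (8, 11), (9, 11), (8, 12), (10, 12), (11, 12), (10, 13), (12, 13), (9, 14), (11, 14)]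

/-- Approximate coordinates, in thousandths. -/
def TX : Fin 15 → ℤ := ![0, 920, 1840, 121, 2760, 1041, 1961, 0, 2194, 998, 3191, 1628, 2625, 3621, 640]
def TY : Fin 15 → ℤ := ![2980, 2589, 2197, 1988, 1805, 1596, 1204, 995, 981, 934, 903, 157, 78, 0, 0]

set_option maxHeartbeats 2000000 in
lemma exists_quarter : ∃ X Y : Fin 15 → ℝ,
    (X 0 = 0 ∧ X 7 = 0 ∧ Y 13 = 0 ∧ Y 14 = 0) ∧
    (∀ e ∈ quarterEdges, (X e.1 - X e.2) ^ 2 + (Y e.1 - Y e.2) ^ 2 = 1) ∧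
    (∀ k, |1000 * X k - TX k| ≤ 15 ∧ |1000 * Y k - TY k| ≤ 15) := by
  obtain ⟨s, sl, su, hF⟩ := exists_root
  obtain ⟨⟨cl, cu⟩, ⟨ql, qu⟩, ⟨dl, du⟩, ⟨il, iu⟩, ⟨hl, hu⟩, ⟨kl, ku⟩, ⟨ml, mu⟩, ⟨Exl, Exu⟩, ⟨Eyl, Eyu⟩, ⟨rsl, rsu⟩, ⟨rcl, rcu⟩, ⟨rql, rqu⟩, ⟨rExl, rExu⟩, ⟨rEyl, rEyu⟩, ⟨rl, ru⟩, ⟨gal, gau⟩, ⟨gbl, gbu⟩, ⟨Dxl, Dxu⟩, ⟨Dyl, Dyu⟩⟩ := box_w sl su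
  have sss := pm_bd sl su sl su (by norm_num) (by norm_num) le_rfl le_rfl
  have mms := pm_bd ml mu ml mu (by norm_num) (by norm_num) le_rfl le_rfl
  norm_num only at sss mms
  have hr : rr ^ 2 = 3 := Real.sq_sqrt (by norm_num)
  have hc : cc s ^ 2 = 1 - s * s := Real.sq_sqrt (by linarith [sss.2])
  have hq : qq s ^ 2 = 4 - s * s := Real.sq_sqrt (by linarith [sss.2])
  have hh2 : hh s ^ 2 = 1 / d2 s - 1 / 4 := Real.sq_sqrt (by linarith)
  have hk : kk s ^ 2 = 1 - mm s * mm s := Real.sq_sqrt (by linarith [mms.2])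
  have hd : (hh s ^ 2 + 1 / 4) * (Dx s * Dx s + Dy s * Dy s) = 1 := by
    have : d2 s ≠ 0 := by intro h0; rw [h0] at dl; norm_num at dl
    rw [hh2]
    change (1 / d2 s - 1 / 4 + 1 / 4) * d2 s = 1
    field_simp
    ring
  have eDx : Dx s = (cc s + qq s) / 2 + rr * s := rfl
  have eDy : Dy s = (rr * qq s - rr * cc s) / 2 := rfl
  have eEx : Ex s = Dx s / 2 - hh s * Dy s := rfl
  have eEy : Ey s = Dy s / 2 + hh s * Dx s := rfl
  have em : mm s = (rr * Ey s - Ex s) / 2 := rfl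
  have ega : ga s = 3 / 2 * (Ex s + rr * Ey s) - Dx s := rfl
  have egb : gb s = Dy s - 2 * Ey s + rr * Ex s - kk s := rfl
  have eF : ga s * ga s + gb s * gb s - 1 = 0 := hF
  have hE : Ex s ^ 2 + Ey s ^ 2 = 1 := by
    rw [eEx, eEy]; linear_combination hd
  have hE' : (Dx s - Ex s) ^ 2 + (Dy s - Ey s) ^ 2 = 1 := by
    rw [eEx, eEy]; linear_combination hd
  generalize cc s = c at *
  generalize qq s = q at *
  generalize Dx s = Dx at *
  generalize Dy s = Dy at *
  generalize Ex s = ex at *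
  generalize Ey s = ey at *
  generalize mm s = m at *
  generalize kk s = k at *
  generalize ga s = ga at *
  generalize gb s = gb at *
  generalize rr = r at *
  clear sss mms hF hh2 hd eEx eEy dl du il iu hl hu
  -- direction of the long strip, and horizontal offset of the vertex 25
  obtain ⟨dx, hdx⟩ : ∃ dx, dx = -(ex + r * ey) / 2 := ⟨_, rfl⟩
  obtain ⟨dy, hdy⟩ : ∃ dy, dy = (r * ex - ey) / 2 := ⟨_, rfl⟩
  obtain ⟨x7, hx7⟩ : ∃ x7, x7 = - 3 * dx := ⟨_, rfl⟩
  obtain ⟨y7, hy7⟩ : ∃ y7, y7 = (s + r * q) / 2 := ⟨_, rfl⟩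
  obtain ⟨u, hu⟩ : ∃ u, u = x7 - (c + q / 2 + r * s / 2) := ⟨_, rfl⟩
  have hD : dx ^ 2 + dy ^ 2 = 1 := by
    rw [hdx, hdy]; linear_combination (ex ^ 2 + ey ^ 2) / 4 * hr + hE
  have hDE : (dx + ex) ^ 2 + (dy + ey) ^ 2 = 1 := by
    rw [hdx, hdy]; linear_combination (ex ^ 2 + ey ^ 2) / 4 * hr + hE
  have h16x : x7 - Dx = u + (c - r * s) / 2 := by rw [hu, eDx]; ring
  have h16y : y7 - Dy = (r * c + s) / 2 := by rw [hy7, eDy]; ring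
  have hx7' : x7 = u + c + q / 2 + r * s / 2 := by rw [hu]; ring
  have hm : x7 - ex + 2 * dx = m := by rw [hx7, em, hdx]; ring
  have hga : x7 - Dx = ga := by rw [hx7, ega, hdx]; ring
  have hgb : y7 - ey + 2 * dy - k - (y7 - Dy) = gb := by rw [egb, hdy]; ring
  refine ⟨![x7 + 3 * dx, x7 + 2 * dx, x7 + dx, x7 - ex + 2 * dx, x7, x7 - ex + dx, x7 - ex, 0,
      u + c + q / 4 + r * s / 4, x7 - Dx, u + c + 3 * q / 4 + r * s / 4, u + c,
      u + c + q / 2, u + c + q, u],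
    ![y7 + 3 * dy, y7 + 2 * dy, y7 + dy, y7 - ey + 2 * dy, y7, y7 - ey + dy, y7 - ey,
      y7 - ey + 2 * dy - k, (3 * s + r * q) / 4, y7 - Dy, (s + r * q) / 4, s, s / 2, 0, 0],
    ⟨?_, rfl, rfl, rfl⟩, ?_, ?_⟩
  · change x7 + 3 * dx = 0
    rw [hx7]; ring
  · intro e he
    simp only [quarterEdges, List.mem_cons, List.not_mem_nil, or_false] at he
    rcases he with rfl | rfl | rfl | rfl | rfl | rfl | rfl | rfl | rfl | rfl | rfl | rfl | rfl | rfl | rfl | rfl | rfl | rfl | rfl | rfl | rfl | rfl | rfl | rfl | rfl | rfl <;>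
    simp only [Matrix.cons_val] <;>
    first
    | linear_combination hD
    | linear_combination hE
    | linear_combination hDE
    | linear_combination hE'
    | linear_combination hc
    | linear_combination hq / 4
    | linear_combination (q ^ 2 + s ^ 2) / 16 * hr + hq / 4
    | (rw [hm]; linear_combination hk)
    | (rw [hgb, hga]; linear_combination eF)
    | (rw [h16x, h16y]; linear_combination (c ^ 2 + s ^ 2) / 4 * hr + hc)
    | (rw [hx7', hy7]; linear_combination (q ^ 2 + s ^ 2) / 16 * hr + hq / 4)
  · intro k
    fin_cases k <;> refine ⟨abs_le.2 ⟨?_, ?_⟩, abs_le.2 ⟨?_, ?_⟩⟩ <;> simp [TX, TY] <;> linarith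

/-! ### The whole graph -/

/-- The edges of the Harborth graph. -/
def edges : List (ℕ × ℕ) := [(0, 1), (0, 2), (1, 3), (2, 4), (0, 5), (1, 5), (0, 6), (2, 6), (3, 7), (4, 8), (1, 9), (3, 9), (5, 9), (2, 10), (4, 10), (6, 10), (3, 11), (7, 11), (9, 11), (4, 12), (8, 12), (10, 12), (5, 13), (6, 13), (7, 14), (8, 15), (11, 16), (13, 16), (12, 17), (13, 17), (7, 18), (14, 18), (8, 19), (15, 19), (14, 20), (16, 20), (15, 21), (17, 21), (14, 22), (18, 22), (20, 22), (15, 23), (19, 23), (21, 23), (18, 24), (22, 24), (16, 25), (20, 25), (17, 26), (21, 26), (19, 27), (23, 27), (24, 28), (27, 29), (25, 30), (28, 30), (26, 31), (29, 31), (24, 32), (28, 32), (27, 33), (29, 33), (25, 34), (30, 34), (26, 35), (31, 35), (28, 36), (30, 36), (32, 36), (29, 37), (31, 37), (33, 37), (34, 38), (35, 38), (34, 39), (35, 40), (39, 41), (40, 42), (32, 43), (36, 43), (39, 43), (33, 44), (37, 44), (40, 44), (38, 45), (41, 45), (38, 46), (42, 46), (39, 47), (41, 47), (43, 47), (40, 48),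 (42, 48), (44, 48), (41, 49), (45, 49), (47, 49), (42, 50), (46, 50), (48, 50), (45, 51), (46, 51), (49, 51), (50, 51)]

/-- The same list as `quarterEdges`, with natural numbers. -/
def quarterEdgesN : List (ℕ × ℕ) := [(0, 1), (1, 2), (0, 3), (1, 3), (2, 4), (1, 5), (2, 5), (3, 5), (2, 6), (4, 6), (5, 6), (3, 7), (4, 8), (6, 9), (7, 9), (4, 10), (8, 10), (8, 11), (9, 11), (8, 12), (10, 12), (11, 12), (10, 13), (12, 13), (9, 14), (11, 14)]

lemma quarterEdgesN_eq : quarterEdgesN = quarterEdges.map fun e => (e.1.val, e.2.val) := by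
  decide +kernel

/-- The orbit of a vertex under the two reflections (packed into a numeral, base 16). -/
def qi (v : ℕ) : ℕ := 1720789079551588376151022673994275617489457848497295464734992 / 16 ^ v % 16

/-- The signs of the coordinates of a vertex (packed into numerals, base 2). -/
def sx (v : ℕ) : ℤ := if Nat.beq (1501016657401172 / 2 ^ v % 2) 0 then 1 else -1
def sy (v : ℕ) : ℤ := if Nat.beq (4503599358935040 / 2 ^ v % 2) 0 then 1 else -1

/-- Approximate coordinates of all vertices, shifted by 5000 and packed into numerals. -/
def NX (v : ℕ) : ℕ := 2185002175467296992581488033488700363039925758088968413914355692267421630013359534635536119659182946960571893562408986552565922385442952281482996912610855507800088631005179306408008936126180387841881865055508858491375587383313029131718263081260815240 / 2 ^ (16 * v) % 65536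
def NY (v : ℕ) : ℕ := 882745964452003752865100126843378503289458444372768676588055453111569248052926651459471323035353782026781863903577697212967824509078577850974373534006701243271729629135211725467491783402622846056120920645793436837748294082477000443902418592129687340 / 2 ^ (16 * v) % 65536
def IX (v : ℕ) : ℤ := (NX v : ℤ) - 5000
def IY (v : ℕ) : ℤ := (NY v : ℤ) - 5000

lemma qi_lt (v : ℕ) (hv : v < 52) : qi v < 15 := by
  have : ∀ v : Fin 52, qi v < 15 := by decide +kernel
  exact this ⟨v, hv⟩

lemma IX_eq : ∀ v : Fin 52, IX v = sx v * TX ⟨qi v, qi_lt v v.2⟩ := by decide +kernel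
lemma IY_eq : ∀ v : Fin 52, IY v = sy v * TY ⟨qi v, qi_lt v v.2⟩ := by decide +kernel

lemma sx_sign (v : ℕ) : sx v = 1 ∨ sx v = -1 := by unfold sx; split <;> simp
lemma sy_sign (v : ℕ) : sy v = 1 ∨ sy v = -1 := by unfold sy; split <;> simp

/-- Every edge is a mirror image of an edge of the quarter. -/
lemma edges_quarter : ∀ e ∈ edges,
    ((qi e.1, qi e.2) ∈ quarterEdgesN ∨ (qi e.2, qi e.1) ∈ quarterEdgesN) ∧
    (sx e.1 = sx e.2 ∨ qi e.1 = 0 ∨ qi e.1 = 7 ∨ qi e.2 = 0 ∨ qi e.2 = 7) ∧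
    (sy e.1 = sy e.2 ∨ qi e.1 = 13 ∨ qi e.1 = 14 ∨ qi e.2 = 13 ∨ qi e.2 = 14) := by
  decide +kernel

/-- The linear functional `(a, b)` is certainly smaller at `u` than at `v`. -/
def sepD (a b : ℤ) (u v : ℕ) : Bool :=
  decide (30 * ((a.natAbs : ℤ) + (b.natAbs : ℤ)) < a * (IX v - IX u) + b * (IY v - IY u))

def sepDir (e f : ℕ × ℕ) (d : ℤ × ℤ) : Bool :=
  sepD d.1 d.2 e.1 f.1 && sepD d.1 d.2 e.1 f.2 && sepD d.1 d.2 e.2 f.1 && sepD d.1 d.2 e.2 f.2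

def dirsOf (p q : ℤ) : List (ℤ × ℤ) := [(-q, p), (q, -p), (p, q), (-p, -q)]

/-- Quick tests for separation by a horizontal or vertical line. -/
def quickX (e f : ℕ × ℕ) : Bool :=
  Nat.ble (NX e.1 + 31) (NX f.1) && Nat.ble (NX e.1 + 31) (NX f.2) &&
  Nat.ble (NX e.2 + 31) (NX f.1) && Nat.ble (NX e.2 + 31) (NX f.2)
def quickY (e f : ℕ × ℕ) : Bool :=
  Nat.ble (NY e.1 + 31) (NY f.1) && Nat.ble (NY e.1 + 31) (NY f.2) &&
  Nat.ble (NY e.2 + 31) (NY f.1) && Nat.ble (NY e.2 + 31) (NY f.2)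

lemma beq_iff' {a b : ℕ} : Nat.beq a b = true ↔ a = b :=
  ⟨Nat.eq_of_beq_eq_true, fun h => h ▸ Nat.beq_refl a⟩

def shared (e f : ℕ × ℕ) : Bool :=
  Nat.beq e.1 f.1 || Nat.beq e.1 f.2 || Nat.beq e.2 f.1 || Nat.beq e.2 f.2

def okPair (e f : ℕ × ℕ) : Bool :=
  quickX e f || quickX f e || quickY e f || quickY f e || shared e f ||
  (dirsOf (IX e.2 - IX e.1) (IY e.2 - IY e.1)).any (sepDir e f) ||
  (dirsOf (IX f.2 - IX f.1) (IY f.2 - IY f.1)).any (sepDir e f)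

def okAll : List (ℕ × ℕ) → Bool
  | [] => true
  | e :: l => l.all (okPair e) && okAll l

lemma okAll_spec : ∀ l, okAll l = true → ∀ e ∈ l, ∀ f ∈ l,
    e = f ∨ okPair e f = true ∨ okPair f e = true
  | [], _, e, he, _, _ => by simp at he
  | a :: l, h, e, he, f, hf => by
    simp only [okAll, Bool.and_eq_true, List.all_eq_true] at h
    rcases List.mem_cons.1 he with rfl | he' <;> rcases List.mem_cons.1 hf with rfl | hf'
    · exact Or.inl rfl
    · exact Or.inr (Or.inl (h.1 f hf'))
    · exact Or.inr (Or.inr (h.1 e he'))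
    · exact okAll_spec l h.2 e he' f hf'

lemma okAll_edges : okAll edges = true := by decide +kernel

lemma sep_vertices : ∀ u v : Fin 52, (u.val == v.val ||
    Nat.ble (NX u + 31) (NX v) || Nat.ble (NX v + 31) (NX u) ||
    Nat.ble (NY u + 31) (NY v) || Nat.ble (NY v + 31) (NY u)) = true := by
  decide +kernel

lemma edges_ne : ∀ e ∈ edges, e.1 ≠ e.2 ∧ e.1 < 52 ∧ e.2 < 52 := by decide +kernel

/-- The neighbours of a vertex. -/
def nb (v : ℕ) : List ℕ := edges.filterMap fun e =>
  if Nat.beq e.1 v then some e.2 else if Nat.beq e.2 v then some e.1 else none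

lemma nb_len : ∀ v : Fin 52, (nb v).length = 4 ∧ (nb v).Nodup := by decide +kernel

lemma mem_nb {v w : ℕ} : w ∈ nb v ↔ ((v, w) ∈ edges ∨ (w, v) ∈ edges) := by
  simp only [nb, List.mem_filterMap, beq_iff']
  constructor
  · rintro ⟨⟨a, b⟩, he, h⟩
    dsimp only at h
    split_ifs at h with h1 h2
    · simp only [Option.some.injEq] at h
      subst h h1
      exact Or.inl he
    · simp only [Option.some.injEq] at h
      subst h h2
      exact Or.inr he
  · rintro (h | h)
    · exact ⟨_, h, by simp⟩
    · exact ⟨_, h, by simp [(edges_ne _ h).1]⟩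

lemma degree_four (v : Fin 52) :
    {w : Fin 52 | (v.val, w.val) ∈ edges ∨ (w.val, v.val) ∈ edges}.ncard = 4 := by
  have h1 : (Fin.val '' {w : Fin 52 | (v.val, w.val) ∈ edges ∨ (w.val, v.val) ∈ edges}) =
      ((nb v).toFinset : Set ℕ) := by
    ext w
    simp only [Set.mem_image, Set.mem_ofPred_eq, List.coe_toFinset, mem_nb]
    constructor
    · rintro ⟨w', h, rfl⟩
      exact h
    · intro h
      have hw : w < 52 := by
        rcases h with h | h
        · exact (edges_ne _ h).2.2
        · exact (edges_ne _ h).2.1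
      exact ⟨⟨w, hw⟩, h, rfl⟩
  rw [← Set.ncard_image_of_injective _ Fin.val_injective, h1, Set.ncard_coe_finset,
    List.toFinset_card_of_nodup (nb_len v).2, (nb_len v).1]

lemma sepD_spec {x y : Fin 52 → ℝ} (hx : ∀ v, |1000 * x v - IX v| ≤ 15)
    (hy : ∀ v, |1000 * y v - IY v| ≤ 15) {a b : ℤ} {u v : Fin 52} (h : sepD a b u v = true) :
    (a : ℝ) * x u + b * y u < a * x v + b * y v := by
  have h1 := of_decide_eq_true h
  have h2 : (30 * (|(a : ℝ)| + |(b : ℝ)|)) <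
      a * ((IX v : ℝ) - IX u) + b * ((IY v : ℝ) - IY u) := by
    rw [Int.natCast_natAbs, Int.natCast_natAbs] at h1
    exact_mod_cast h1
  have key : ∀ (a z w p q : ℝ), |1000 * z - p| ≤ 15 → |1000 * w - q| ≤ 15 →
      a * (q - p) - 30 * |a| ≤ 1000 * (a * w - a * z) := by
    intro a z w p q hz hw
    have e1 : |a * ((q - 1000 * w) + (1000 * z - p))| ≤ |a| * 30 := by
      rw [abs_mul]
      refine mul_le_mul_of_nonneg_left ?_ (abs_nonneg _)
      refine (abs_add_le _ _).trans ?_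
      rw [abs_sub_comm q]
      linarith
    have := (abs_le.1 e1).2
    linarith
  have k1 := key a _ _ _ _ (hx u) (hx v)
  have k2 := key b _ _ _ _ (hy u) (hy v)
  linarith

lemma segment_functional {p q z : EuclideanSpace ℝ (Fin 2)} (hz : z ∈ segment ℝ p q) (a b : ℝ) :
    ∃ s t : ℝ, 0 ≤ s ∧ 0 ≤ t ∧ s + t = 1 ∧
      a * z 0 + b * z 1 = s * (a * p 0 + b * p 1) + t * (a * q 0 + b * q 1) := by
  obtain ⟨s, t, hs, ht, hst, rfl⟩ := hz
  refine ⟨s, t, hs, ht, hst, ?_⟩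
  simp
  ring

lemma disjoint_of_functional {p q p' q' : EuclideanSpace ℝ (Fin 2)} (a b : ℝ)
    (h1 : a * p 0 + b * p 1 < a * p' 0 + b * p' 1)
    (h2 : a * p 0 + b * p 1 < a * q' 0 + b * q' 1)
    (h3 : a * q 0 + b * q 1 < a * p' 0 + b * p' 1)
    (h4 : a * q 0 + b * q 1 < a * q' 0 + b * q' 1) :
    segment ℝ p q ∩ segment ℝ p' q' = ∅ := by
  rw [Set.eq_empty_iff_forall_notMem]
  rintro z ⟨hz, hz'⟩
  obtain ⟨s, t, hs, ht, hst, e⟩ := segment_functional hz a b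
  obtain ⟨s', t', hs', ht', hst', e'⟩ := segment_functional hz' a b
  generalize a * p 0 + b * p 1 = A at *
  generalize a * q 0 + b * q 1 = B at *
  generalize a * p' 0 + b * p' 1 = C at *
  generalize a * q' 0 + b * q' 1 = D at *
  have u1 : s * A + t * B ≤ max A B := by
    calc s * A + t * B ≤ s * max A B + t * max A B := by
          gcongr
          · exact le_max_left _ _
          · exact le_max_right _ _
      _ = max A B := by rw [← add_mul, hst, one_mul]
  have u2 : min C D ≤ s' * C + t' * D := by
    calc min C D = s' * min C D + t' * min C D := by rw [← add_mul, hst', one_mul]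
      _ ≤ s' * C + t' * D := by
          gcongr
          · exact min_le_left _ _
          · exact min_le_right _ _
  have u3 : max A B < min C D := max_lt (lt_min h1 h2) (lt_min h3 h4)
  linarith

lemma quick_lt {x : Fin 52 → ℝ} {N : ℕ → ℕ}
    (hx : ∀ v : Fin 52, |1000 * x v - ((((N v : ℕ) : ℤ) - 5000 : ℤ) : ℝ)| ≤ 15) {u v : Fin 52}
    (h : Nat.ble (N u + 31) (N v) = true) : x u < x v := by
  have h1 : N u + 31 ≤ N v := Nat.le_of_ble_eq_true h
  have h2 : (N u : ℝ) + 31 ≤ N v := by exact_mod_cast h1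
  have h3 := (abs_le.1 (hx u)).2
  have h4 := (abs_le.1 (hx v)).1
  push_cast at h3 h4
  linarith

lemma okPair_spec {x y : Fin 52 → ℝ} (hx : ∀ v : Fin 52, |1000 * x v - IX v| ≤ 15)
    (hy : ∀ v : Fin 52, |1000 * y v - IY v| ≤ 15) {i j i' j' : Fin 52}
    (hn : ¬ (i = i' ∨ i = j' ∨ j = i' ∨ j = j'))
    (h : okPair (i, j) (i', j') = true) :
    segment ℝ (!₂[x i, y i] : EuclideanSpace ℝ (Fin 2)) !₂[x j, y j] ∩
      segment ℝ !₂[x i', y i'] !₂[x j', y j'] = ∅ := by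
  simp only [okPair, Bool.or_eq_true, List.any_eq_true] at h
  have main : ∀ d : ℤ × ℤ, sepDir (i, j) (i', j') d = true →
      segment ℝ (!₂[x i, y i] : EuclideanSpace ℝ (Fin 2)) !₂[x j, y j] ∩
        segment ℝ !₂[x i', y i'] !₂[x j', y j'] = ∅ := by
    intro d hd
    simp only [sepDir, Bool.and_eq_true] at hd
    obtain ⟨⟨⟨d1, d2⟩, d3⟩, d4⟩ := hd
    exact disjoint_of_functional (d.1 : ℝ) (d.2 : ℝ)
      (sepD_spec hx hy d1) (sepD_spec hx hy d2) (sepD_spec hx hy d3) (sepD_spec hx hy d4)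
  rcases h with (((((h | h) | h) | h) | h) | ⟨d, -, h⟩) | ⟨d, -, h⟩
  · simp only [quickX, Bool.and_eq_true] at h
    obtain ⟨⟨⟨d1, d2⟩, d3⟩, d4⟩ := h
    refine disjoint_of_functional 1 0 ?_ ?_ ?_ ?_ <;>
      simpa using quick_lt hx (by assumption)
  · simp only [quickX, Bool.and_eq_true] at h
    obtain ⟨⟨⟨d1, d2⟩, d3⟩, d4⟩ := h
    rw [Set.inter_comm]
    refine disjoint_of_functional 1 0 ?_ ?_ ?_ ?_ <;>
      simpa using quick_lt hx (by assumption)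
  · simp only [quickY, Bool.and_eq_true] at h
    obtain ⟨⟨⟨d1, d2⟩, d3⟩, d4⟩ := h
    refine disjoint_of_functional 0 1 ?_ ?_ ?_ ?_ <;>
      simpa using quick_lt hy (by assumption)
  · simp only [quickY, Bool.and_eq_true] at h
    obtain ⟨⟨⟨d1, d2⟩, d3⟩, d4⟩ := h
    rw [Set.inter_comm]
    refine disjoint_of_functional 0 1 ?_ ?_ ?_ ?_ <;>
      simpa using quick_lt hy (by assumption)
  · simp only [shared, Bool.or_eq_true, beq_iff', ← Fin.ext_iff] at h
    exact absurd (by tauto) hn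
  · exact main d h
  · exact main d h

end Harborth

/-- There exists a finite `4`-regular matchstick graph with exactly `52` vertices
(the Harborth graph); in particular `m(4) ≤ 52`. -/
theorem exists_four_regular_matchstick_graph_on_fiftytwo_vertices :
    ∃ (G : SimpleGraph (Fin 52)) (g : Fin 52 → EuclideanSpace ℝ (Fin 2)),
      (∀ v : Fin 52, (G.neighborSet v).ncard = 4) ∧ IsMatchstickEmbedding G g := by
  classical
  obtain ⟨X, Y, ⟨hX0, hX7, hY13, hY14⟩, hQ, hB⟩ := Harborth.exists_quarter
  obtain ⟨X', hX'⟩ : ∃ X' : ℕ → ℝ, ∀ k : Fin 15, X' k.val = X k :=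
    ⟨fun n => if h : n < 15 then X ⟨n, h⟩ else 0, fun k => by simp⟩
  obtain ⟨Y', hY'⟩ : ∃ Y' : ℕ → ℝ, ∀ k : Fin 15, Y' k.val = Y k :=
    ⟨fun n => if h : n < 15 then Y ⟨n, h⟩ else 0, fun k => by simp⟩
  replace hX0 : X' 0 = 0 := (hX' 0).trans hX0
  replace hX7 : X' 7 = 0 := (hX' 7).trans hX7
  replace hY13 : Y' 13 = 0 := (hY' 13).trans hY13
  replace hY14 : Y' 14 = 0 := (hY' 14).trans hY14
  replace hQ : ∀ e ∈ Harborth.quarterEdgesN,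
      (X' e.1 - X' e.2) ^ 2 + (Y' e.1 - Y' e.2) ^ 2 = 1 := by
    intro e he
    rw [Harborth.quarterEdgesN_eq, List.mem_map] at he
    obtain ⟨e', he', rfl⟩ := he
    dsimp only
    rw [hX', hX', hY', hY']
    exact hQ e' he'
  obtain ⟨x, hxdef⟩ : ∃ x : ℕ → ℝ, ∀ v, x v = Harborth.sx v * X' (Harborth.qi v) :=
    ⟨_, fun _ => rfl⟩
  obtain ⟨y, hydef⟩ : ∃ y : ℕ → ℝ, ∀ v, y v = Harborth.sy v * Y' (Harborth.qi v) :=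
    ⟨_, fun _ => rfl⟩
  have hx : ∀ v : Fin 52, |1000 * x v - Harborth.IX v| ≤ 15 := by
    intro v
    have h := (hB ⟨Harborth.qi v, Harborth.qi_lt v v.2⟩).1
    rw [← hX'] at h
    rw [Harborth.IX_eq, hxdef]
    rcases Harborth.sx_sign v with h1 | h1 <;> rw [h1] <;> push_cast <;>
      rw [abs_le] at h ⊢ <;> constructor <;> linarith [h.1, h.2]
  have hy : ∀ v : Fin 52, |1000 * y v - Harborth.IY v| ≤ 15 := by
    intro v
    have h := (hB ⟨Harborth.qi v, Harborth.qi_lt v v.2⟩).2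
    rw [← hY'] at h
    rw [Harborth.IY_eq, hydef]
    rcases Harborth.sy_sign v with h1 | h1 <;> rw [h1] <;> push_cast <;>
      rw [abs_le] at h ⊢ <;> constructor <;> linarith [h.1, h.2]
  have hsx2 : ∀ v, (Harborth.sx v : ℝ) ^ 2 = 1 := by
    intro v
    rcases Harborth.sx_sign v with h1 | h1 <;> rw [h1] <;> norm_num
  have hsy2 : ∀ v, (Harborth.sy v : ℝ) ^ 2 = 1 := by
    intro v
    rcases Harborth.sy_sign v with h1 | h1 <;> rw [h1] <;> norm_num
  -- unit lengths
  have hlen : ∀ e ∈ Harborth.edges, (x e.1 - x e.2) ^ 2 + (y e.1 - y e.2) ^ 2 = 1 := by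
    intro e he
    obtain ⟨h1, h2, h3⟩ := Harborth.edges_quarter e he
    have k1 : (x e.1 - x e.2) ^ 2 = (X' (Harborth.qi e.1) - X' (Harborth.qi e.2)) ^ 2 := by
      rw [hxdef, hxdef]
      have a1 := hsx2 e.1
      have a2 := hsx2 e.2
      rcases h2 with h | h | h | h | h
      · rw [← h]; linear_combination (X' (Harborth.qi e.1) - X' (Harborth.qi e.2)) ^ 2 * a1
      · rw [h, hX0]; linear_combination (X' (Harborth.qi e.2)) ^ 2 * a2
      · rw [h, hX7]; linear_combination (X' (Harborth.qi e.2)) ^ 2 * a2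
      · rw [h, hX0]; linear_combination (X' (Harborth.qi e.1)) ^ 2 * a1
      · rw [h, hX7]; linear_combination (X' (Harborth.qi e.1)) ^ 2 * a1
    have k2 : (y e.1 - y e.2) ^ 2 = (Y' (Harborth.qi e.1) - Y' (Harborth.qi e.2)) ^ 2 := by
      rw [hydef, hydef]
      have a1 := hsy2 e.1
      have a2 := hsy2 e.2
      rcases h3 with h | h | h | h | h
      · rw [← h]; linear_combination (Y' (Harborth.qi e.1) - Y' (Harborth.qi e.2)) ^ 2 * a1
      · rw [h, hY13]; linear_combination (Y' (Harborth.qi e.2)) ^ 2 * a2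
      · rw [h, hY14]; linear_combination (Y' (Harborth.qi e.2)) ^ 2 * a2
      · rw [h, hY13]; linear_combination (Y' (Harborth.qi e.1)) ^ 2 * a1
      · rw [h, hY14]; linear_combination (Y' (Harborth.qi e.1)) ^ 2 * a1
    rw [k1, k2]
    rcases h1 with h | h
    · exact hQ _ h
    · linear_combination hQ _ h
  have hlen' : ∀ i j : Fin 52, (i.val, j.val) ∈ Harborth.edges →
      dist (!₂[x i, y i] : EuclideanSpace ℝ (Fin 2)) !₂[x j, y j] = 1 := by
    intro i j h
    rw [EuclideanSpace.dist_eq, Fin.sum_univ_two, Real.sqrt_eq_one]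
    simp only [Real.dist_eq, sq_abs]
    exact hlen _ h
  -- disjointness of segments
  have hseg : ∀ i j i' j' : Fin 52, (i.val, j.val) ∈ Harborth.edges →
      (i'.val, j'.val) ∈ Harborth.edges → ¬ (i = i' ∨ i = j' ∨ j = i' ∨ j = j') →
      segment ℝ (!₂[x i, y i] : EuclideanSpace ℝ (Fin 2)) !₂[x j, y j] ∩
        segment ℝ !₂[x i', y i'] !₂[x j', y j'] = ∅ := by
    intro i j i' j' h h' hn
    rcases Harborth.okAll_spec _ Harborth.okAll_edges _ h _ h' with h0 | h0 | h0
    · exact absurd (Or.inl (Fin.ext (congrArg Prod.fst h0))) hn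
    · exact Harborth.okPair_spec (x := fun v : Fin 52 => x v) (y := fun v : Fin 52 => y v)
        hx hy hn h0
    · rw [Set.inter_comm]
      refine Harborth.okPair_spec (x := fun v : Fin 52 => x v) (y := fun v : Fin 52 => y v)
        hx hy ?_ h0
      rintro (e | e | e | e) <;> simp [e] at hn
  refine ⟨SimpleGraph.fromRel fun i j => (i.val, j.val) ∈ Harborth.edges,
    fun v => !₂[x v, y v], ?_, ?_, ?_, ?_⟩
  · intro v
    rw [← Harborth.degree_four v]
    congr 1
    ext w
    simp only [SimpleGraph.mem_neighborSet, SimpleGraph.fromRel_adj, Set.mem_ofPred_eq,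
      and_iff_right_iff_imp]
    rintro (h | h) rfl
    · exact (Harborth.edges_ne _ h).1 rfl
    · exact (Harborth.edges_ne _ h).1 rfl
  · intro u v huv
    have e0 : x u = x v := congrArg (fun z : EuclideanSpace ℝ (Fin 2) => z 0) huv
    have e1 : y u = y v := congrArg (fun z : EuclideanSpace ℝ (Fin 2) => z 1) huv
    have := Harborth.sep_vertices u v
    simp only [Bool.or_eq_true, beq_iff_eq] at this
    rcases this with (((h | h) | h) | h) | h
    · exact Fin.ext h
    · exact absurd e0 (Harborth.quick_lt (x := fun v : Fin 52 => x v) hx h).ne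
    · exact absurd e0 (Harborth.quick_lt (x := fun v : Fin 52 => x v) hx h).ne'
    · exact absurd e1 (Harborth.quick_lt (x := fun v : Fin 52 => y v) hy h).ne
    · exact absurd e1 (Harborth.quick_lt (x := fun v : Fin 52 => y v) hy h).ne'
  · intro i j hij
    rw [SimpleGraph.fromRel_adj] at hij
    rcases hij.2 with h | h
    · exact hlen' _ _ h
    · rw [dist_comm]; exact hlen' _ _ h
  · intro i j i' j' h h' hdis
    rw [SimpleGraph.fromRel_adj] at h h'
    have hn : ∀ w, w ∈ ({i, j} : Set (Fin 52)) → w ∈ ({i', j'} : Set (Fin 52)) → False := by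
      intro w h1 h2
      have : w ∈ ({i, j} : Set (Fin 52)) ∩ {i', j'} := ⟨h1, h2⟩
      rw [hdis] at this
      exact this
    have n1 : i ≠ i' := fun e => hn i (by simp) (by simp [e])
    have n2 : i ≠ j' := fun e => hn i (by simp) (by simp [e])
    have n3 : j ≠ i' := fun e => hn j (by simp) (by simp [e])
    have n4 : j ≠ j' := fun e => hn j (by simp) (by simp [e])
    rcases h.2 with h | h <;> rcases h'.2 with h' | h'
    · exact hseg _ _ _ _ h h' (by tauto)
    · rw [segment_symm ℝ _ !₂[x j', y j']]
      exact hseg _ _ _ _ h h' (by tauto)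
    · rw [segment_symm ℝ _ !₂[x j, y j]]
      exact hseg _ _ _ _ h h' (by tauto)
    · rw [segment_symm ℝ _ !₂[x j, y j], segment_symm ℝ _ !₂[x j', y j']]
      exact hseg _ _ _ _ h h' (by tauto)
end

section
/- Let V be a finite set, let a : V → (Fin 5 → ℕ) assign to each vertex five face sizes with a(v)(i) ≥ 3 for all v and i, let E be a natural number, and let F : ℕ → ℕ be finitely supported with F(j) = 0 for j < 3. Suppose that for every j the number of pairs (v,i) with a(v)(i) = j equals j·F(j), that |V| + ∑_j F(j) = E + 2, and that ∑_j j·F(j) = 2·E = 5·|V|. Then ∑_{v ∈ V} ∑_{i} (10 − 3·a(v)(i)) / a(v)(i) = 20, where the sum is taken in ℚ. -/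
open Finset

/-- `c(V) = 20` for a finite `5`-regular matchstick graph: if each vertex `v` has
five incident face sizes `a v 0, …, a v 4 ≥ 3`, each `j`-gon is counted `j` times
among the pairs `(v, i)`, and Euler's formula together with the incidence double
counts `∑ j * F j = 2E = 5|V|` hold, then
`∑_{v} ∑_{i} (10 - 3 * a v i) / (a v i) = 20` in `ℚ`. -/
theorem contribution_sum_eq_twenty (V : Type) [Fintype V]
    (a : V → Fin 5 → ℕ) (ha : ∀ (v : V) (i : Fin 5), 3 ≤ a v i)
    (E : ℕ) (F : ℕ →₀ ℕ) (hF : ∀ j < 3, F j = 0)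
    (hcount : ∀ j : ℕ,
      ((Finset.univ : Finset (V × Fin 5)).filter (fun p => a p.1 p.2 = j)).card
        = j * F j)
    (hEuler : Fintype.card V + F.sum (fun _ m => m) = E + 2)
    (hEdges : F.sum (fun j m => j * m) = 2 * E)
    (hVerts : 2 * E = 5 * Fintype.card V) :
    ∑ v : V, ∑ i : Fin 5, ((10 - 3 * (a v i : ℚ)) / (a v i : ℚ)) = 20 := by
  have hmem : ∀ p ∈ (Finset.univ : Finset (V × Fin 5)), a p.1 p.2 ∈ F.support := by
    intro p _
    rw [Finsupp.mem_support_iff]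
    intro h0
    have h := hcount (a p.1 p.2)
    rw [h0, mul_zero, Finset.card_eq_zero] at h
    have hp : p ∈ (Finset.univ : Finset (V × Fin 5)).filter
        (fun q => a q.1 q.2 = a p.1 p.2) := by simp
    rw [h] at hp
    simp at hp
  have key : ∑ v : V, ∑ i : Fin 5, ((10 - 3 * (a v i : ℚ)) / (a v i : ℚ))
      = ∑ j ∈ F.support, (10 * (F j : ℚ) - 3 * ((j : ℚ) * (F j : ℚ))) := by
    rw [← Fintype.sum_prod_type' (fun v i => (10 - 3 * (a v i : ℚ)) / (a v i : ℚ)),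
      ← Finset.sum_fiberwise_of_maps_to hmem]
    refine Finset.sum_congr rfl fun j hj => ?_
    have hj0 : (j : ℚ) ≠ 0 := by
      intro h
      have h' : j = 0 := by exact_mod_cast h
      exact (Finsupp.mem_support_iff.mp hj) (hF j (by omega))
    have hc : ∀ p ∈ (Finset.univ : Finset (V × Fin 5)).filter (fun p => a p.1 p.2 = j),
        (10 - 3 * (a p.1 p.2 : ℚ)) / (a p.1 p.2 : ℚ) = (10 - 3 * (j : ℚ)) / j := by
      intro p hp
      rw [(Finset.mem_filter.mp hp).2]
    rw [Finset.sum_congr rfl hc, Finset.sum_const, hcount j, nsmul_eq_mul]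
    push_cast
    field_simp
  rw [key, Finset.sum_sub_distrib, ← Finset.mul_sum, ← Finset.mul_sum]
  have h1 : (Fintype.card V : ℚ) + ∑ j ∈ F.support, (F j : ℚ) = E + 2 := by
    exact_mod_cast hEuler
  have h2 : ∑ j ∈ F.support, (j : ℚ) * (F j : ℚ) = 2 * E := by
    exact_mod_cast hEdges
  have h3 : (2 : ℚ) * E = 5 * Fintype.card V := by exact_mod_cast hVerts
  linarith
end

section
/- Let a₁ ≤ a₂ ≤ a₃ ≤ a₄ ≤ a₅ be integers with a₁ ≥ 3 and a₅ ≥ 4. Then ∑_{i=1}^{5} (10 − 3·aᵢ)/aᵢ ≥ 0 (as a rational number) if and only if (a₁,a₂,a₃,a₄,a₅) is one of (3,3,3,3,4), (3,3,3,4,4), (3,3,3,3,5), (3,3,3,3,6); moreover in these four cases the sum equals 5/6, 0, 1/3 and 0 respectively. -/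
/-- The contribution `c(a) = (10 - 3a)/a` of a face with `a` corners. -/
def faceContribution (a : ℤ) : ℚ := (10 - 3 * (a : ℚ)) / (a : ℚ)

lemma faceContribution_anti {a b : ℤ} (hb : 3 ≤ b) (h : b ≤ a) :
    faceContribution a ≤ faceContribution b := by
  have hb' : (3 : ℚ) ≤ b := by exact_mod_cast hb
  have h' : (b : ℚ) ≤ a := by exact_mod_cast h
  unfold faceContribution
  rw [div_le_div_iff₀ (by linarith) (by linarith)]
  nlinarith

/-- Classification of the face sets with non-negative contribution: for integers
`3 ≤ a₁ ≤ a₂ ≤ a₃ ≤ a₄ ≤ a₅` with `a₅ ≥ 4`, the contribution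
`c(a₁)+⋯+c(a₅)` is non-negative iff `(a₁,…,a₅)` is one of `(3,3,3,3,4)`,
`(3,3,3,4,4)`, `(3,3,3,3,5)`, `(3,3,3,3,6)`; in these cases the contribution is
`5/6`, `0`, `1/3` and `0` respectively. -/
theorem nonneg_contribution_classification (a₁ a₂ a₃ a₄ a₅ : ℤ)
    (h12 : a₁ ≤ a₂) (h23 : a₂ ≤ a₃) (h34 : a₃ ≤ a₄) (h45 : a₄ ≤ a₅)
    (h1 : 3 ≤ a₁) (h5 : 4 ≤ a₅) :
    (0 ≤ faceContribution a₁ + faceContribution a₂ + faceContribution a₃ +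
        faceContribution a₄ + faceContribution a₅ ↔
      (a₁, a₂, a₃, a₄, a₅) = (3, 3, 3, 3, 4) ∨
      (a₁, a₂, a₃, a₄, a₅) = (3, 3, 3, 4, 4) ∨
      (a₁, a₂, a₃, a₄, a₅) = (3, 3, 3, 3, 5) ∨
      (a₁, a₂, a₃, a₄, a₅) = (3, 3, 3, 3, 6)) ∧
    faceContribution 3 + faceContribution 3 + faceContribution 3 +
      faceContribution 3 + faceContribution 4 = 5 / 6 ∧
    faceContribution 3 + faceContribution 3 + faceContribution 3 +
      faceContribution 4 + faceContribution 4 = 0 ∧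
    faceContribution 3 + faceContribution 3 + faceContribution 3 +
      faceContribution 3 + faceContribution 5 = 1 / 3 ∧
    faceContribution 3 + faceContribution 3 + faceContribution 3 +
      faceContribution 3 + faceContribution 6 = 0 := by
  have c3 : faceContribution 3 = 1 / 3 := by norm_num [faceContribution]
  have c4 : faceContribution 4 = -1 / 2 := by norm_num [faceContribution]
  have c5 : faceContribution 5 = -1 := by norm_num [faceContribution]
  have c6 : faceContribution 6 = -4 / 3 := by norm_num [faceContribution]
  have c7 : faceContribution 7 = -11 / 7 := by norm_num [faceContribution]
  refine ⟨⟨fun h => ?_, ?_⟩, ?_, ?_, ?_, ?_⟩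
  · have k1 := faceContribution_anti (a := a₁) (b := 3) le_rfl (by omega)
    have k2 := faceContribution_anti (a := a₂) (b := 3) le_rfl (by omega)
    have k3 := faceContribution_anti (a := a₃) (b := 3) le_rfl (by omega)
    have k4 := faceContribution_anti (a := a₄) (b := 3) le_rfl (by omega)
    have e3 : a₃ = 3 := by
      by_contra hne
      have m3 := faceContribution_anti (a := a₃) (b := 4) (by norm_num) (by omega)
      have m4 := faceContribution_anti (a := a₄) (b := 4) (by norm_num) (by omega)
      have m5 := faceContribution_anti (a := a₅) (b := 4) (by norm_num) (by omega)
      linarith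
    simp only [Prod.mk.injEq]
    by_cases e4 : a₄ = 3
    · have e5 : a₅ < 7 := by
        by_contra hne
        have m5 := faceContribution_anti (a := a₅) (b := 7) (by norm_num) (by omega)
        linarith
      omega
    · have e5 : a₅ < 5 := by
        by_contra hne
        have m4 := faceContribution_anti (a := a₄) (b := 4) (by norm_num) (by omega)
        have m5 := faceContribution_anti (a := a₅) (b := 5) (by norm_num) (by omega)
        linarith
      omega
  · simp only [Prod.mk.injEq]
    rintro (⟨rfl, rfl, rfl, rfl, rfl⟩ | ⟨rfl, rfl, rfl, rfl, rfl⟩ |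
      ⟨rfl, rfl, rfl, rfl, rfl⟩ | ⟨rfl, rfl, rfl, rfl, rfl⟩) <;> linarith
  all_goals linarith
end

section
/- There exists an infinite 5-regular matchstick graph: a simple graph G = (V,E) on a countably infinite vertex set in which every vertex has degree 5, together with an injective map g : V → ℝ² such that every edge of G joins points at Euclidean distance 1 and the closed segments of any two vertex-disjoint edges are disjoint. -/
/-- Directed edges of the triangular lattice with a perfect matching removed. -/
def MStep (p q : ℤ × ℤ) : Prop :=
  (q.1 = p.1 + 1 ∧ q.2 = p.2) ∨ (q.1 = p.1 ∧ q.2 = p.2 + 1) ∨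
    (q.1 = p.1 + 1 ∧ q.2 = p.2 - 1 ∧ p.2 % 2 = 0)

/-- The triangular lattice minus a perfect matching. -/
def MGraph : SimpleGraph (ℤ × ℤ) where
  Adj p q := MStep p q ∨ MStep q p
  symm := ⟨fun _ _ h => h.symm⟩
  loopless := ⟨fun p h => by simp only [MStep] at h; omega⟩

/-- The embedding of the triangular lattice in the plane. -/
noncomputable def mEmb (p : ℤ × ℤ) : EuclideanSpace ℝ (Fin 2) :=
  !₂[(p.1 : ℝ) + p.2 / 2, Real.sqrt 3 / 2 * p.2]

theorem mEmb_injective : Function.Injective mEmb := by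
  rintro ⟨a, b⟩ ⟨c, d⟩ h
  have h0 := congrArg (fun v => v 0) h
  have h1 := congrArg (fun v => v 1) h
  simp [mEmb] at h0 h1
  subst h1
  simp at h0
  simp [h0]

theorem mEmb_dist {p q : ℤ × ℤ} (h : MStep p q) : dist (mEmb p) (mEmb q) = 1 := by
  obtain ⟨a, b⟩ := p
  obtain ⟨c, d⟩ := q
  have h3 : Real.sqrt 3 ^ 2 = 3 := Real.sq_sqrt (by norm_num)
  rw [EuclideanSpace.dist_eq, Real.sqrt_eq_one]
  simp only [Fin.sum_univ_two, Real.dist_eq, sq_abs, mEmb]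
  simp only [MStep] at h
  rcases h with ⟨rfl, rfl⟩ | ⟨rfl, rfl⟩ | ⟨rfl, rfl, -⟩ <;> simp <;> ring_nf <;>
    (try rw [h3]) <;> norm_num

theorem int_unit {t : ℝ} {n : ℤ} (h0 : 0 ≤ t) (h1 : t ≤ 1) (h : t = n) : n = 0 ∨ n = 1 := by
  subst h
  have : 0 ≤ n := by exact_mod_cast h0
  have : n ≤ 1 := by exact_mod_cast h1
  omega

theorem int_diff {s t : ℝ} {n : ℤ} (h0 : 0 ≤ t) (h1 : t ≤ 1) (k0 : 0 ≤ s) (k1 : s ≤ 1)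
    (h : t - s = n) : -1 ≤ n ∧ n ≤ 1 := by
  have h2 : ((-1 : ℤ) : ℝ) ≤ n := by push_cast; linarith
  have h3 : (n : ℝ) ≤ (1 : ℤ) := by push_cast; linarith
  exact ⟨by exact_mod_cast h2, by exact_mod_cast h3⟩

theorem mEmb_cross {p q r u : ℤ × ℤ} (h : MStep p q) (k : MStep r u)
    {x : EuclideanSpace ℝ (Fin 2)} (hx : x ∈ segment ℝ (mEmb p) (mEmb q))
    (kx : x ∈ segment ℝ (mEmb r) (mEmb u)) : p = r ∨ p = u ∨ q = r ∨ q = u := by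
  obtain ⟨a, b⟩ := p
  obtain ⟨a', b'⟩ := q
  obtain ⟨c, d⟩ := r
  obtain ⟨c', d'⟩ := u
  rw [segment_eq_image] at hx kx
  obtain ⟨t, ⟨t0, t1⟩, rfl⟩ := hx
  obtain ⟨s, ⟨s0, s1⟩, e⟩ := kx
  have e0 := congrArg (fun v => v 0) e
  have e1 := congrArg (fun v => v 1) e
  simp [mEmb] at e0 e1
  have h3 : Real.sqrt 3 ≠ 0 := by positivity
  have e2 : (1 - s) * d + s * d' = (1 - t) * b + t * (b' : ℝ) := by
    apply mul_left_cancel₀ h3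
    linarith
  have e3 : (1 - s) * c + s * c' = (1 - t) * a + t * (a' : ℝ) := by
    linarith
  clear e0 e1 e
  simp only [MStep] at h k
  simp only [Prod.mk.injEq]
  rcases h with ⟨h1, h2⟩ | ⟨h1, h2⟩ | ⟨h1, h2, -⟩ <;>
  rcases k with ⟨k1, k2⟩ | ⟨k1, k2⟩ | ⟨k1, k2, -⟩ <;>
  rw [h2, k2] at e2 <;> rw [h1, k1] at e3 <;> push_cast at e2 e3
  · have := int_diff (n := c - a) t0 t1 s0 s1 (by push_cast; linarith)
    have : d = b := by exact_mod_cast (by linarith : (d : ℝ) = b)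
    omega
  · have := int_unit (n := c - a) t0 t1 (by push_cast; linarith)
    have := int_unit (n := b - d) s0 s1 (by push_cast; linarith)
    omega
  · have := int_unit (n := c + d - a - b) t0 t1 (by push_cast; linarith)
    have := int_unit (n := d - b) s0 s1 (by push_cast; linarith)
    omega
  · have := int_unit (n := d - b) t0 t1 (by push_cast; linarith)
    have := int_unit (n := a - c) s0 s1 (by push_cast; linarith)
    omega
  · have := int_diff (n := d - b) t0 t1 s0 s1 (by push_cast; linarith)
    have : c = a := by exact_mod_cast (by linarith : (c : ℝ) = a)
    omega
  · have := int_unit (n := c + d - a - b) t0 t1 (by push_cast; linarith)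
    have := int_unit (n := a - c) s0 s1 (by push_cast; linarith)
    omega
  · have := int_unit (n := b - d) t0 t1 (by push_cast; linarith)
    have := int_unit (n := a + b - c - d) s0 s1 (by push_cast; linarith)
    omega
  · have := int_unit (n := c - a) t0 t1 (by push_cast; linarith)
    have := int_unit (n := a + b - c - d) s0 s1 (by push_cast; linarith)
    omega
  · have := int_diff (n := c - a) t0 t1 s0 s1 (by push_cast; linarith)
    have : c + d = a + b := by exact_mod_cast (by linarith : (c : ℝ) + d = a + b)
    omega

theorem mGraph_degree (v : ℤ × ℤ) : (MGraph.neighborSet v).ncard = 5 := by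
  obtain ⟨a, b⟩ := v
  rcases Int.emod_two_eq_zero_or_one b with hb | hb
  · have : MGraph.neighborSet (a, b) = (({(a + 1, b), (a - 1, b), (a, b + 1), (a, b - 1),
        (a + 1, b - 1)} : Finset (ℤ × ℤ)) : Set (ℤ × ℤ)) := by
      ext ⟨c, d⟩
      simp only [SimpleGraph.mem_neighborSet, MGraph, MStep, Finset.coe_insert,
        Finset.coe_singleton, Set.mem_insert_iff, Set.mem_singleton_iff, Prod.mk.injEq]
      omega
    rw [this, Set.ncard_coe_finset]
    repeat rw [Finset.card_insert_of_notMem (by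
      simp only [Finset.mem_insert, Finset.mem_singleton, Prod.mk.injEq]; omega)]
    simp
  · have : MGraph.neighborSet (a, b) = (({(a + 1, b), (a - 1, b), (a, b + 1), (a, b - 1),
        (a - 1, b + 1)} : Finset (ℤ × ℤ)) : Set (ℤ × ℤ)) := by
      ext ⟨c, d⟩
      simp only [SimpleGraph.mem_neighborSet, MGraph, MStep, Finset.coe_insert,
        Finset.coe_singleton, Set.mem_insert_iff, Set.mem_singleton_iff, Prod.mk.injEq]
      omega
    rw [this, Set.ncard_coe_finset]
    repeat rw [Finset.card_insert_of_notMem (by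
      simp only [Finset.mem_insert, Finset.mem_singleton, Prod.mk.injEq]; omega)]
    simp

/-- There exists an infinite `5`-regular matchstick graph: a simple graph on a
countably infinite vertex set in which every vertex has degree `5`, together with
a matchstick embedding in the plane. -/
theorem exists_infinite_five_regular_matchstick_graph :
    ∃ (V : Type) (_ : Countable V) (_ : Infinite V) (G : SimpleGraph V)
      (g : V → EuclideanSpace ℝ (Fin 2)),
      (∀ v : V, (G.neighborSet v).ncard = 5) ∧ IsMatchstickEmbedding G g := by
  refine ⟨ℤ × ℤ, inferInstance, inferInstance, MGraph, mEmb, mGraph_degree, mEmb_injective,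
    ?_, ?_⟩
  · rintro i j (h | h)
    · exact mEmb_dist h
    · rw [dist_comm]; exact mEmb_dist h
  · intro p q r u h k hd
    rw [Set.eq_empty_iff_forall_notMem]
    rintro x ⟨hx, kx⟩
    have key : p = r ∨ p = u ∨ q = r ∨ q = u := by
      rcases h with h | h <;> rcases k with k | k
      · exact mEmb_cross h k hx kx
      · have := mEmb_cross h k hx (segment_symm ℝ (mEmb r) (mEmb u) ▸ kx)
        tauto
      · have := mEmb_cross h k (segment_symm ℝ (mEmb p) (mEmb q) ▸ hx) kx
        tauto
      · have := mEmb_cross h k (segment_symm ℝ (mEmb p) (mEmb q) ▸ hx) (segment_symm ℝ (mEmb r) (mEmb u) ▸ kx)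
        tauto
    rw [Set.eq_empty_iff_forall_notMem] at hd
    have hp := hd p
    have hq := hd q
    simp only [Set.mem_inter_iff, Set.mem_insert_iff, Set.mem_singleton_iff] at hp hq
    tauto
end

section
/- There exists an uncountable family of simple graphs on a countably infinite vertex set, pairwise non-isomorphic as abstract graphs, each of which is an infinite 5-regular matchstick graph, i.e. each admits an injective map of its vertex set into ℝ² under which every edge joins points at Euclidean distance 1 and the closed segments of any two vertex-disjoint edges are disjoint, and in each of which every vertex has degree 5. -/
namespace Matchstick

/-- Row offsets encoded by a binary sequence; rows with index `≤ 0` are not shifted. -/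
def offs (f : ℕ → Bool) (b : ℤ) : ℤ :=
  if b ≤ 0 then 0 else if f (b - 1).toNat then 1 else 0

/-- Adjacency: triangular lattice minus a perfect matching of each row. -/
def A (c : ℤ → ℤ) (p q : ℤ × ℤ) : Prop :=
  (q.2 = p.2 ∧ ((q.1 = p.1 + 1 ∧ (p.1 + c p.2) % 2 = 1) ∨ (p.1 = q.1 + 1 ∧ (q.1 + c p.2) % 2 = 1)))
  ∨ (q.2 = p.2 + 1 ∧ (q.1 = p.1 ∨ q.1 = p.1 - 1))
  ∨ (p.2 = q.2 + 1 ∧ (p.1 = q.1 ∨ p.1 = q.1 - 1))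

/-- The graph with row shifts `c`. -/
def H (c : ℤ → ℤ) : SimpleGraph (ℤ × ℤ) where
  Adj := A c
  symm := ⟨by
    rintro ⟨a, b⟩ ⟨a', b'⟩ h
    unfold A at *
    simp only at *
    rcases h with ⟨rfl, h⟩ | h | h
    · left; omega
    · right; right; omega
    · right; left; omega⟩
  loopless := ⟨by
    rintro ⟨a, b⟩ h
    unfold A at h
    simp only at h
    omega⟩

lemma H_adj (c : ℤ → ℤ) (a b a' b' : ℤ) : (H c).Adj (a, b) (a', b') ↔
  ((b' = b ∧ ((a' = a + 1 ∧ (a + c b) % 2 = 1) ∨ (a = a' + 1 ∧ (a' + c b) % 2 = 1)))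
  ∨ (b' = b + 1 ∧ (a' = a ∨ a' = a - 1))
  ∨ (b = b' + 1 ∧ (a = a' ∨ a = a' - 1))) := Iff.rfl

lemma ncard_five {α : Type*} (x1 x2 x3 x4 x5 : α) (h : [x1, x2, x3, x4, x5].Nodup) :
    ({x1, x2, x3, x4, x5} : Set α).ncard = 5 := by
  classical
  have : ({x1, x2, x3, x4, x5} : Set α) = (([x1, x2, x3, x4, x5].toFinset : Finset α) : Set α) := by
    ext; simp
  rw [this, Set.ncard_coe_finset, List.toFinset_card_of_nodup h]
  rfl

lemma H_deg (c : ℤ → ℤ) (v : ℤ × ℤ) : ((H c).neighborSet v).ncard = 5 := by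
  obtain ⟨a, b⟩ := v
  obtain ⟨e, he⟩ : ∃ e : ℤ, (e = a + 1 ∧ (a + c b) % 2 = 1) ∨ (e = a - 1 ∧ (a + c b) % 2 = 0) := by
    rcases Int.emod_two_eq_zero_or_one (a + c b) with h | h
    · exact ⟨a - 1, Or.inr ⟨rfl, h⟩⟩
    · exact ⟨a + 1, Or.inl ⟨rfl, h⟩⟩
  have : (H c).neighborSet (a, b) = {(e, b), (a, b+1), (a-1, b+1), (a, b-1), (a+1, b-1)} := by
    ext ⟨a', b'⟩
    simp only [SimpleGraph.mem_neighborSet, H_adj, Set.mem_insert_iff, Set.mem_singleton_iff,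
      Prod.mk.injEq]
    omega
  rw [this]
  apply ncard_five
  simp only [List.nodup_cons, List.mem_cons, Prod.mk.injEq, List.not_mem_nil, not_false_iff,
    List.nodup_nil, or_false, and_true]
  omega

/-- Planar position of lattice points. -/
noncomputable def pos (p : ℤ × ℤ) : EuclideanSpace ℝ (Fin 2) :=
  !₂[(p.1 : ℝ) + p.2 / 2, Real.sqrt 3 / 2 * p.2]

lemma pos_inj : Function.Injective pos := by
  rintro ⟨a, b⟩ ⟨a', b'⟩ h
  have h0 := congrArg (fun v => v 0) h
  have h1 := congrArg (fun v => v 1) h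
  simp [pos] at h0 h1
  subst h1
  simp at h0
  simp [h0]

lemma pos_dist (c : ℤ → ℤ) (p q : ℤ × ℤ) (h : (H c).Adj p q) : dist (pos p) (pos q) = 1 := by
  obtain ⟨a, b⟩ := p
  obtain ⟨a', b'⟩ := q
  rw [H_adj] at h
  have h3 : Real.sqrt 3 ^ 2 = 3 := Real.sq_sqrt (by norm_num)
  rw [EuclideanSpace.dist_eq, Real.sqrt_eq_one]
  simp only [Fin.sum_univ_two, pos, Real.dist_eq, sq_abs]
  simp
  have key : ((a:ℝ) - a')^2 + (a - a') * (b - b') + (b - b')^2 = 1 := by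
    have : (a - a')^2 + (a - a') * (b - b') + (b - b')^2 = 1 := by
      rcases h with ⟨rfl, ⟨rfl, -⟩ | ⟨rfl, -⟩⟩ | ⟨rfl, rfl | rfl⟩ | ⟨rfl, rfl | rfl⟩ <;> ring
    exact_mod_cast this
  linear_combination key + ((b:ℝ) - b')^2 / 4 * h3

lemma sep (x y z w : ℤ) (s t s' t' : ℝ) (hs : 0 ≤ s) (ht : 0 ≤ t) (hst : s + t = 1)
    (hs' : 0 ≤ s') (ht' : 0 ≤ t') (hst' : s' + t' = 1)
    (h : s * x + t * y = s' * z + t' * w) : (x ≤ z ∨ x ≤ w ∨ y ≤ z ∨ y ≤ w) := by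
  by_contra! hc
  obtain ⟨h1, h2, h3, h4⟩ := hc
  have hm : ∃ m : ℤ, z ≤ m ∧ w ≤ m ∧ m + 1 ≤ x ∧ m + 1 ≤ y :=
    ⟨max z w, by omega, by omega, by omega, by omega⟩
  obtain ⟨m, a1, a2, a3, a4⟩ := hm
  have b1 : (z:ℝ) ≤ m := by exact_mod_cast a1
  have b2 : (w:ℝ) ≤ m := by exact_mod_cast a2
  have b3 : (m:ℝ) + 1 ≤ x := by exact_mod_cast a3
  have b4 : (m:ℝ) + 1 ≤ y := by exact_mod_cast a4
  have c1 := mul_le_mul_of_nonneg_left b1 hs'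
  have c2 := mul_le_mul_of_nonneg_left b2 ht'
  have c3 := mul_le_mul_of_nonneg_left b3 hs
  have c4 := mul_le_mul_of_nonneg_left b4 ht
  have e1 : s * ((m:ℝ)+1) + t * (m+1) = m + 1 := by rw [← add_mul, hst, one_mul]
  have e2 : s' * (m:ℝ) + t' * m = m := by rw [← add_mul, hst', one_mul]
  linarith

/-- Canonically oriented lattice edge from `(a, b)` to `(a₂, b₂)`; the first coordinates of its
points range over `[l, u]`. -/
def Dir (a b a₂ b₂ l u : ℤ) : Prop :=
  (b₂ = b ∧ a₂ = a + 1 ∧ l = a ∧ u = a + 1) ∨ (b₂ = b + 1 ∧ a₂ = a ∧ l = a ∧ u = a) ∨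
    (b₂ = b + 1 ∧ a₂ = a - 1 ∧ l = a - 1 ∧ u = a)

lemma Dir.bounds {a b a₂ b₂ l u : ℤ} (h : Dir a b a₂ b₂ l u) :
    b ≤ b₂ ∧ a + b ≤ a₂ + b₂ ∧ l ≤ a ∧ l ≤ a₂ ∧ a ≤ u ∧ a₂ ≤ u := by
  unfold Dir at h; omega

lemma int_share {a b a₂ b₂ l u a' b' a₂' b₂' l' u' : ℤ} (h : Dir a b a₂ b₂ l u)
    (h' : Dir a' b' a₂' b₂' l' u')
    (g0 : l ≤ u') (g1 : b ≤ b₂') (g2 : a + b ≤ a₂' + b₂')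
    (k0 : l' ≤ u) (k1 : b' ≤ b₂) (k2 : a' + b' ≤ a₂ + b₂) :
    (a = a' ∧ b = b') ∨ (a = a₂' ∧ b = b₂') ∨ (a₂ = a' ∧ b₂ = b') ∨ (a₂ = a₂' ∧ b₂ = b₂') := by
  rcases h with ⟨rfl, rfl, rfl, rfl⟩ | ⟨rfl, rfl, rfl, rfl⟩ | ⟨rfl, rfl, rfl, rfl⟩ <;>
  rcases h' with ⟨rfl, rfl, rfl, rfl⟩ | ⟨rfl, rfl, rfl, rfl⟩ | ⟨rfl, rfl, rfl, rfl⟩ <;>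
  omega

lemma coords (p q p' q' : ℤ × ℤ) (s t s' t' : ℝ)
    (e : s' • pos p' + t' • pos q' = s • pos p + t • pos q) :
   s * (p.2:ℝ) + t * q.2 = s' * p'.2 + t' * q'.2 ∧ s * (p.1:ℝ) + t * q.1 = s' * p'.1 + t' * q'.1  := by
  have e0 := congrArg (fun v => v 0) e
  have e1 := congrArg (fun v => v 1) e
  simp [pos] at e0 e1
  have h3 : Real.sqrt 3 ≠ 0 := by positivity
  have f1 : s * (p.2:ℝ) + t * q.2 = s' * p'.2 + t' * q'.2 := by
    apply mul_left_cancel₀ h3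
    linear_combination (-2) * e1
  exact ⟨f1, by linear_combination -e0 - f1 / 2⟩

lemma pos_disj_dir (a b a₂ b₂ l u a' b' a₂' b₂' l' u' : ℤ) (h : Dir a b a₂ b₂ l u)
    (h' : Dir a' b' a₂' b₂' l' u')
    (n1 : (a, b) ≠ (a', b')) (n2 : (a, b) ≠ (a₂', b₂')) (n3 : (a₂, b₂) ≠ (a', b'))
    (n4 : (a₂, b₂) ≠ (a₂', b₂')) :
    segment ℝ (pos (a, b)) (pos (a₂, b₂)) ∩ segment ℝ (pos (a', b')) (pos (a₂', b₂')) = ∅ := by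
  rw [Set.eq_empty_iff_forall_notMem]
  rintro P ⟨⟨s, t, hs, ht, hst, e1⟩, ⟨s', t', hs', ht', hst', e2⟩⟩
  obtain ⟨f1, f0⟩ := coords _ _ _ _ _ _ _ _ (e2.trans e1.symm)
  clear e1 e2
  simp only at f0 f1
  have f2 : s * ((a+b : ℤ):ℝ) + t * ((a₂+b₂ : ℤ) : ℝ)
    = s' * ((a'+b' : ℤ) : ℝ) + t' * ((a₂'+b₂' : ℤ) : ℝ) := by push_cast; linear_combination f0 + f1
  have g1 := sep _ _ _ _ _ _ _ _ hs ht hst hs' ht' hst' f1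
  have g0 := sep _ _ _ _ _ _ _ _ hs ht hst hs' ht' hst' f0
  have g2 := sep _ _ _ _ _ _ _ _ hs ht hst hs' ht' hst' f2
  have k1 := sep _ _ _ _ _ _ _ _ hs' ht' hst' hs ht hst f1.symm
  have k0 := sep _ _ _ _ _ _ _ _ hs' ht' hst' hs ht hst f0.symm
  have k2 := sep _ _ _ _ _ _ _ _ hs' ht' hst' hs ht hst f2.symm
  obtain ⟨d1, d2, d3, d4, d5, d6⟩ := h.bounds
  obtain ⟨d1', d2', d3', d4', d5', d6'⟩ := h'.bounds
  simp only [ne_eq, Prod.mk.injEq] at n1 n2 n3 n4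
  rcases int_share h h' (by clear * - g0 d3 d4 d5' d6'; omega)
    (by clear * - g1 d1 d1'; omega) (by clear * - g2 d2 d2'; omega)
    (by clear * - k0 d3' d4' d5 d6; omega)
    (by clear * - k1 d1 d1'; omega) (by clear * - k2 d2 d2'; omega) with hh | hh | hh | hh
  · exact n1 hh
  · exact n2 hh
  · exact n3 hh
  · exact n4 hh

lemma dir_of_adj (c : ℤ → ℤ) (a b a₂ b₂ : ℤ) (h : (H c).Adj (a, b) (a₂, b₂)) :
    ∃ l u, Dir a b a₂ b₂ l u ∨ Dir a₂ b₂ a b l u := by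
  rw [H_adj] at h
  refine ⟨min a a₂, max a a₂, ?_⟩
  unfold Dir
  rcases h with ⟨rfl, ⟨rfl, -⟩ | ⟨rfl, -⟩⟩ | ⟨rfl, rfl | rfl⟩ | ⟨rfl, rfl | rfl⟩ <;> omega

lemma pos_disj (c : ℤ → ℤ) (p q p' q' : ℤ × ℤ) (h : (H c).Adj p q) (h' : (H c).Adj p' q')
    (n1 : p ≠ p') (n2 : p ≠ q') (n3 : q ≠ p') (n4 : q ≠ q') :
    segment ℝ (pos p) (pos q) ∩ segment ℝ (pos p') (pos q') = ∅ := by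
  obtain ⟨a, b⟩ := p
  obtain ⟨a₂, b₂⟩ := q
  obtain ⟨a', b'⟩ := p'
  obtain ⟨a₂', b₂'⟩ := q'
  obtain ⟨l, u, h | h⟩ := dir_of_adj _ _ _ _ _ h <;>
  obtain ⟨l', u', h' | h'⟩ := dir_of_adj _ _ _ _ _ h'
  · exact pos_disj_dir _ _ _ _ _ _ _ _ _ _ _ _ h h' n1 n2 n3 n4
  · rw [segment_symm ℝ (pos (a', b'))]
    exact pos_disj_dir _ _ _ _ _ _ _ _ _ _ _ _ h h' n2 n1 n4 n3
  · rw [segment_symm ℝ (pos (a, b))]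
    exact pos_disj_dir _ _ _ _ _ _ _ _ _ _ _ _ h h' n3 n4 n1 n2
  · rw [segment_symm ℝ (pos (a', b')), segment_symm ℝ (pos (a, b))]
    exact pos_disj_dir _ _ _ _ _ _ _ _ _ _ _ _ h h' n4 n3 n2 n1

/-- An isomorphism fixing one triangle forces equal shift sequences. -/
lemma rigid (c d : ℤ → ℤ) (hc : ∀ b, c b = 0 ∨ c b = 1) (hd : ∀ b, d b = 0 ∨ d b = 1)
    (c0 : c 0 = 0) (d0 : d 0 = 0) (φ : H c ≃g H d)
    (h1 : φ (1, 0) = (1, 0)) (h2 : φ (2, 0) = (2, 0)) (h3 : φ (1, 1) = (1, 1)) (n : ℕ) :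
    c n = d n ∧ ∃ a : ℤ, (a + c n) % 2 = 1 ∧ φ (a, n) = (a, (n:ℤ)) ∧
      φ (a + 1, n) = (a + 1, (n:ℤ)) ∧ φ (a, n + 1) = (a, (n:ℤ) + 1) := by
  induction n with
  | zero =>
    refine ⟨by simp [c0, d0], 1, by simp [c0], ?_⟩
    simpa using ⟨h1, h2, h3⟩
  | succ n ih =>
    obtain ⟨-, a, -, hx, hy, hz⟩ := ih
    push_cast
    generalize (n : ℤ) = m at *
    have hcm := hc (m + 1)
    have hdm := hd (m + 1)
    have adj : ∀ p q : ℤ × ℤ, (H c).Adj p q → (H d).Adj (φ p) (φ q) :=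
      fun p q h => φ.map_adj_iff.mpr h
    have ne : ∀ p q : ℤ × ℤ, p ≠ q → φ p ≠ φ q := fun p q h => φ.injective.ne h
    rcases Int.emod_two_eq_zero_or_one (a + c (m + 1)) with hp | hp
    · have w1 := adj (a - 1, m + 1) (a, m) (by rw [H_adj]; omega)
      have w2 := adj (a - 1, m + 1) (a, m + 1) (by rw [H_adj]; omega)
      have w3 := ne (a - 1, m + 1) (a + 1, m) (by simp)
      have hw : φ (a - 1, m + 1) = (a - 1, m + 1) ∧ (a - 1 + d (m + 1)) % 2 = 1 := by
        rcases hh : φ (a - 1, m + 1) with ⟨u, v⟩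
        rw [hh, hx, H_adj] at w1
        rw [hh, hz, H_adj] at w2
        rw [hh, hy] at w3
        simp only [ne_eq, Prod.mk.injEq] at w3 ⊢
        have hv : v = m + 1 := by omega
        subst hv
        omega
      obtain ⟨hw, hpar⟩ := hw
      refine ⟨by omega, a - 1, by omega, hw, by simpa using hz, ?_⟩
      have z1 := adj (a - 1, m + 1 + 1) (a - 1, m + 1) (by rw [H_adj]; omega)
      have z2 := adj (a - 1, m + 1 + 1) (a, m + 1) (by rw [H_adj]; omega)
      have z3 := ne (a - 1, m + 1 + 1) (a, m) (by simp)
      rcases hh : φ (a - 1, m + 1 + 1) with ⟨u, v⟩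
      rw [hh, hw, H_adj] at z1
      rw [hh, hz, H_adj] at z2
      rw [hh, hx] at z3
      simp only [ne_eq, Prod.mk.injEq] at z3 ⊢
      omega
    · have w1 := adj (a + 1, m + 1) (a + 1, m) (by rw [H_adj]; omega)
      have w2 := adj (a + 1, m + 1) (a, m + 1) (by rw [H_adj]; omega)
      have w3 := ne (a + 1, m + 1) (a, m) (by simp)
      have hw : φ (a + 1, m + 1) = (a + 1, m + 1) ∧ (a + d (m + 1)) % 2 = 1 := by
        rcases hh : φ (a + 1, m + 1) with ⟨u, v⟩
        rw [hh, hy, H_adj] at w1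
        rw [hh, hz, H_adj] at w2
        rw [hh, hx] at w3
        simp only [ne_eq, Prod.mk.injEq] at w3 ⊢
        have hv : v = m + 1 := by omega
        subst hv
        omega
      obtain ⟨hw, hpar⟩ := hw
      refine ⟨by omega, a, by omega, hz, hw, ?_⟩
      have z1 := adj (a, m + 1 + 1) (a, m + 1) (by rw [H_adj]; omega)
      have z2 := adj (a, m + 1 + 1) (a + 1, m + 1) (by rw [H_adj]; omega)
      have z3 := ne (a, m + 1 + 1) (a + 1, m) (by simp)
      rcases hh : φ (a, m + 1 + 1) with ⟨u, v⟩
      rw [hh, hz, H_adj] at z1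
      rw [hh, hw, H_adj] at z2
      rw [hh, hy] at z3
      simp only [ne_eq, Prod.mk.injEq] at z3 ⊢
      omega

lemma offs_mem (f : ℕ → Bool) (b : ℤ) : offs f b = 0 ∨ offs f b = 1 := by
  unfold offs; split_ifs <;> simp

lemma offs_zero (f : ℕ → Bool) : offs f 0 = 0 := by simp [offs]

lemma offs_inj (f g : ℕ → Bool) (h : ∀ n : ℕ, offs f n = offs g n) : f = g := by
  funext n
  have := h (n + 1)
  have h0 : ¬ ((n : ℤ) + 1 ≤ 0) := by omega
  simp only [offs, Nat.cast_add, Nat.cast_one, h0, if_false, add_sub_cancel_right,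
    Int.toNat_natCast] at this
  cases hf : f n <;> cases hg : g n <;> simp_all

/-- Each isomorphism class is countable. -/
lemma class_countable (g : ℕ → Bool) :
    {f : ℕ → Bool | Nonempty (H (offs f) ≃g H (offs g))}.Countable := by
  classical
  let Φ : {f : ℕ → Bool | Nonempty (H (offs f) ≃g H (offs g))} →
      (ℤ × ℤ) × (ℤ × ℤ) × (ℤ × ℤ) := fun f =>
    (f.2.some (1, 0), f.2.some (2, 0), f.2.some (1, 1))
  have hΦ : Function.Injective Φ := by
    intro f f' h
    simp only [Φ, Prod.mk.injEq] at h
    obtain ⟨h1, h2, h3⟩ := h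
    apply Subtype.ext
    apply offs_inj
    intro n
    refine (rigid _ _ (offs_mem _) (offs_mem _) (offs_zero _) (offs_zero _)
      (f.2.some.trans f'.2.some.symm) ?_ ?_ ?_ n).1
    · simp [RelIso.trans_apply, h1]
    · simp [RelIso.trans_apply, h2]
    · simp [RelIso.trans_apply, h3]
  exact hΦ.countable

/-- Isomorphism of the associated graphs. -/
def isoSetoid : Setoid (ℕ → Bool) where
  r f g := Nonempty (H (offs f) ≃g H (offs g))
  iseqv := ⟨fun _ => ⟨SimpleGraph.Iso.refl⟩, fun ⟨e⟩ => ⟨e.symm⟩, fun ⟨e⟩ ⟨e'⟩ => ⟨e.trans e'⟩⟩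

lemma not_countable_quot : ¬ Countable (Quotient isoSetoid) := by
  intro hcount
  have hu : (Set.univ : Set (ℕ → Bool)).Countable := by
    have : (Set.univ : Set (ℕ → Bool)) = ⋃ q : Quotient isoSetoid,
        {f : ℕ → Bool | Nonempty (H (offs f) ≃g H (offs q.out))} := by
      symm
      rw [Set.eq_univ_iff_forall]
      intro f
      rw [Set.mem_iUnion]
      refine ⟨Quotient.mk isoSetoid f, ?_⟩
      exact isoSetoid.symm (Quotient.mk_out (s := isoSetoid) f)
    rw [this]
    exact Set.countable_iUnion fun q => class_countable _
  rw [Set.countable_univ_iff] at hu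
  obtain ⟨F, hF⟩ := exists_surjective_nat (ℕ → Bool)
  obtain ⟨n, hn⟩ := hF (fun k => !(F k k))
  have := congrFun hn n
  simp at this

end Matchstick

/-- There exists an uncountable family of pairwise non-isomorphic simple graphs
on a countably infinite vertex set, each of which is an infinite `5`-regular
matchstick graph. -/
theorem exists_uncountably_many_infinite_five_regular_matchstick_graphs :
    ∃ (ι : Type) (G : ι → SimpleGraph ℕ),
      ¬ Countable ι ∧
      (∀ i j : ι, i ≠ j → ¬ Nonempty (G i ≃g G j)) ∧
      (∀ i : ι, (∀ v : ℕ, ((G i).neighborSet v).ncard = 5) ∧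
        ∃ g : ℕ → EuclideanSpace ℝ (Fin 2), IsMatchstickEmbedding (G i) g) := by
  classical
  let e : ℕ ≃ ℤ × ℤ := (Denumerable.eqv (ℤ × ℤ)).symm
  let K : Quotient Matchstick.isoSetoid → SimpleGraph (ℤ × ℤ) :=
    fun q => Matchstick.H (Matchstick.offs q.out)
  let I : ∀ q, (K q).comap e ≃g K q := fun q => SimpleGraph.Iso.comap e (K q)
  refine ⟨Quotient Matchstick.isoSetoid, fun q => (K q).comap e,
    Matchstick.not_countable_quot, ?_, ?_⟩
  · rintro q q' hne ⟨φ⟩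
    apply hne
    rw [← Quotient.out_eq q, ← Quotient.out_eq q']
    exact Quotient.sound (s := Matchstick.isoSetoid) ⟨(I q).symm.trans (φ.trans (I q'))⟩
  · intro q
    refine ⟨fun v => ?_, fun n => Matchstick.pos (e n), ?_, ?_, ?_⟩
    · rw [← Matchstick.H_deg (Matchstick.offs q.out) (e v)]
      exact Nat.card_congr ((I q).mapNeighborSet v)
    · exact Matchstick.pos_inj.comp e.injective
    · intro i j h
      exact Matchstick.pos_dist _ _ _ h
    · intro i₁ j₁ i₂ j₂ h h' hd
      have hn : ∀ x ∈ ({i₁, j₁} : Set ℕ), ∀ y ∈ ({i₂, j₂} : Set ℕ), e x ≠ e y := by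
        intro x hx y hy hxy
        have hxy' := e.injective hxy
        subst hxy'
        exact (Set.eq_empty_iff_forall_notMem.mp hd x) ⟨hx, hy⟩
      exact Matchstick.pos_disj _ _ _ _ _ h h' (hn _ (by simp) _ (by simp))
        (hn _ (by simp) _ (by simp)) (hn _ (by simp) _ (by simp)) (hn _ (by simp) _ (by simp))
end
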